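/- arXiv:math/0610201 — 7 statements merged into one kernel-verified Lean document; each statement's English description precedes it below -/
import Mathlib

section
/- A ring R is semisimple if and only if the homology functor is faithful on the derived category D(R) of right R-modules; that is, R is semisimple if and only if every morphism f : X → Y in D(R) with H_n(f) = 0 for all n satisfies f = 0. -/
open CategoryTheory CategoryTheory.Limits HomologicalComplex TensorProduct

universe u

section Aux

variable {C : Type*} [Category C] [Abelian C]

lemma aux_vonNeumann (hP : ∀ X : C, Projective X) {A B : C} (f : A ⟶ B) :
    ∃ t : B ⟶ A, f ≫ t ≫ f = f := by
  have := hP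
  let S : ShortComplex C := ShortComplex.mk f (cokernel.π f) (cokernel.condition f)
  have hS : S.Exact := ShortComplex.exact_cokernel f
  let σ : cokernel f ⟶ B := Projective.factorThru (𝟙 _) (cokernel.π f)
  have hσ : σ ≫ cokernel.π f = 𝟙 _ := Projective.factorThru_comp _ _
  have h0 : (𝟙 B - cokernel.π f ≫ σ) ≫ S.g = 0 := by
    simp [S, Preadditive.sub_comp, hσ]
  refine ⟨hS.liftFromProjective (𝟙 B - cokernel.π f ≫ σ) h0, ?_⟩
  have h1 : hS.liftFromProjective (𝟙 B - cokernel.π f ≫ σ) h0 ≫ f = _ :=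
    hS.liftFromProjective_comp _ h0
  rw [h1]
  simp [Preadditive.comp_sub]

lemma aux_lift (hP : ∀ X : C, Projective X) {K L : CochainComplex C ℤ} (g : K ⟶ L)
    (i j k : ℤ) (hij : j + 1 = i) (hik : i + 1 = k)
    (hg : homologyMap g i = 0) {A : C} (x : A ⟶ K.X i) (hx : x ≫ K.d i k = 0) :
    ∃ a : A ⟶ L.X j, a ≫ L.d j i = x ≫ g.f i := by
  have := hP
  have hk : (ComplexShape.up ℤ).next i = k := by simp [hik]
  have hj : (ComplexShape.up ℤ).prev i = j := by simp [← hij]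
  let S : ShortComplex C := ShortComplex.mk _ _ (L.toCycles_comp_homologyπ j i)
  have hS : S.Exact := S.exact_of_g_is_cokernel (L.homologyIsCokernel j i hj)
  have h0 : (K.liftCycles x k hk hx ≫ cyclesMap g i) ≫ S.g = 0 := by
    simp only [S, Category.assoc]
    rw [← homologyπ_naturality, hg]
    simp
  refine ⟨hS.liftFromProjective _ h0, ?_⟩
  have h1 : hS.liftFromProjective _ h0 ≫ L.toCycles j i = _ := hS.liftFromProjective_comp _ h0
  rw [← L.toCycles_i j i, reassoc_of% h1]
  simp

lemma aux_homotopy (hP : ∀ X : C, Projective X) {K L : CochainComplex C ℤ} (g : K ⟶ L)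
    (hg : ∀ i, homologyMap g i = 0) : Nonempty (Homotopy g 0) := by
  choose t ht using fun i j => aux_vonNeumann hP (K.d i j)
  have ha : ∀ i j : ℤ, j + 1 = i → ∃ a : K.X i ⟶ L.X j,
      a ≫ L.d j i = (𝟙 _ - K.d i (i + 1) ≫ t i (i + 1)) ≫ g.f i := by
    intro i j hij
    exact aux_lift hP g i j (i + 1) hij rfl (hg i) _ (by simp [Preadditive.sub_comp, ht])
  choose a ha using ha
  let h : ∀ i j, (ComplexShape.up ℤ).Rel j i → (K.X i ⟶ L.X j) := fun i j hij =>
    t j i ≫ g.f j + (𝟙 _ - t j i ≫ K.d j i) ≫ a i j hij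
  have hh : g = Homotopy.nullHomotopicMap' h := by
    ext i
    obtain ⟨j, rfl⟩ : ∃ j, i = j + 1 := ⟨i - 1, by simp⟩
    rw [Homotopy.nullHomotopicMap'_f (k₂ := j) (k₁ := j + 1) (k₀ := j + 1 + 1) rfl rfl]
    have e1 : K.d (j + 1) (j + 1 + 1) ≫ h (j + 1 + 1) (j + 1) rfl =
        K.d (j + 1) (j + 1 + 1) ≫ t _ _ ≫ g.f (j + 1) := by
      simp only [h, Preadditive.comp_add, Preadditive.sub_comp, Preadditive.comp_sub,
        Category.id_comp, Category.assoc]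
      rw [reassoc_of% (ht (j + 1) (j + 1 + 1))]
      simp
    have e2 : h (j + 1) j rfl ≫ L.d j (j + 1) =
        g.f (j + 1) - K.d (j + 1) (j + 1 + 1) ≫ t _ _ ≫ g.f (j + 1) := by
      simp only [h, Preadditive.add_comp, Category.assoc, ha]
      simp [Preadditive.sub_comp, Preadditive.comp_sub]
      abel
    rw [e1, e2]
    abel
  rw [hh]
  exact ⟨Homotopy.nullHomotopy' h⟩

lemma aux_forward [HasDerivedCategory C] (hP : ∀ X : C, Projective X)
    {X Y : DerivedCategory C} (f : X ⟶ Y)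
    (hf : ∀ n : ℤ, (DerivedCategory.homologyFunctor C n).map f = 0) : f = 0 := by
  let eX := DerivedCategory.Q.objObjPreimageIso X
  let eY := DerivedCategory.Q.objObjPreimageIso Y
  obtain ⟨X', s, hs, g, hg⟩ := DerivedCategory.right_fac (eX.hom ≫ f ≫ eY.inv)
  have hg' : DerivedCategory.Q.map g = DerivedCategory.Q.map s ≫ eX.hom ≫ f ≫ eY.inv := by
    rw [hg]; simp
  have h0 : ∀ n, homologyMap g n = 0 := by
    intro n
    have := DerivedCategory.homologyFunctorFactors_hom_naturality g n
    rw [hg'] at this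
    simp only [Functor.map_comp, hf, zero_comp, comp_zero] at this
    exact (cancel_epi ((DerivedCategory.homologyFunctorFactors C n).hom.app X')).1
      (this.symm.trans comp_zero.symm)
  obtain ⟨H⟩ := aux_homotopy hP g h0
  have h1 := DerivedCategory.Q_map_eq_of_homotopy C H
  rw [h1, Functor.map_zero, comp_zero] at hg
  rw [← cancel_epi eX.hom, ← cancel_mono eY.inv]
  simpa using hg

lemma aux_backward [HasDerivedCategory C]
    (hF : ∀ (X Y : DerivedCategory C) (f : X ⟶ Y),
      (∀ n : ℤ, (DerivedCategory.homologyFunctor C n).map f = 0) → f = 0)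
    {S : ShortComplex C} (hS : S.ShortExact) : ∃ s : S.X₃ ⟶ S.X₂, s ≫ S.g = 𝟙 _ := by
  have hδ : hS.singleδ = 0 := by
    apply hF
    intro n
    by_cases hn : n < 0
    · exact (DerivedCategory.isZero_of_isGE _ 0 n hn).eq_of_src _ _
    · have : (((DerivedCategory.singleFunctor C 0).obj S.X₁)⟦(1 : ℤ)⟧).IsLE (-1) :=
        DerivedCategory.TStructure.t.isLE_shift _ 0 1 (-1) (by simp)
      exact (DerivedCategory.isZero_of_isLE _ (-1) n (by lia)).eq_of_tgt _ _
  obtain ⟨s, hs⟩ := Pretriangulated.Triangle.coyoneda_exact₃ _ hS.singleTriangle_distinguished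
    (𝟙 ((DerivedCategory.singleFunctor C 0).obj S.X₃)) (by
      change _ ≫ hS.singleδ = 0
      rw [hδ, comp_zero])
  obtain ⟨s', rfl⟩ := (DerivedCategory.singleFunctor C 0).map_surjective s
  refine ⟨s', (DerivedCategory.singleFunctor C 0).map_injective ?_⟩
  rw [Functor.map_comp, CategoryTheory.Functor.map_id]
  exact hs.symm

end Aux

theorem semisimple_iff_homology_faithful_on_derived (R : Type u) [Ring R]
    [HasDerivedCategory (ModuleCat.{u} Rᵐᵒᵖ)] :
    (∀ (M : Type u) [AddCommGroup M] [Module Rᵐᵒᵖ M], Module.Projective Rᵐᵒᵖ M) ↔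
      ∀ (X Y : DerivedCategory (ModuleCat.{u} Rᵐᵒᵖ)) (f : X ⟶ Y),
        (∀ n : ℤ, (DerivedCategory.homologyFunctor (ModuleCat.{u} Rᵐᵒᵖ) n).map f = 0) →
          f = 0 := by
  constructor
  · intro h X Y f hf
    refine aux_forward (fun M => ?_) f hf
    exact (IsProjective.iff_projective (R := Rᵐᵒᵖ) M).1 (h M)
  · intro h M _ _
    rw [IsProjective.iff_projective]
    let p := Projective.π (ModuleCat.of Rᵐᵒᵖ M)
    have hS : (ShortComplex.mk (kernel.ι p) p (kernel.condition p)).ShortExact :=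
      { exact := ShortComplex.exact_kernel p }
    obtain ⟨s, hs⟩ := aux_backward h hS
    exact Retract.projective (Y := Projective.over (ModuleCat.of Rᵐᵒᵖ M)) ⟨s, p, hs⟩
end

section
/- A ring R satisfies the strong generating hypothesis if and only if R is von Neumann regular. That is, for all bounded chain complexes P and Q of finitely generated projective right R-modules, the map sending the chain-homotopy class of a chain map f : P → Q to the family (H_n(f))_n is a bijection onto the set of families of R-module homomorphisms (H_n(P) → H_n(Q))_n, if and only if for every x in R there exists y in R with x = xyx. -/
open CategoryTheory CategoryTheory.Limits HomologicalComplex TensorProduct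

universe u

/-- A chain complex of right `R`-modules (i.e. left `Rᵐᵒᵖ`-modules) is perfect if it is
bounded and each term is a finitely generated projective module. -/
def IsPerfect (R : Type u) [Ring R] (P : ChainComplex (ModuleCat.{u} Rᵐᵒᵖ) ℤ) : Prop :=
  (∃ a b : ℤ, ∀ n : ℤ, (n < a ∨ b < n) → IsZero (P.X n)) ∧
    ∀ n : ℤ, Module.Finite Rᵐᵒᵖ (P.X n) ∧ Module.Projective Rᵐᵒᵖ (P.X n)

/-- The map sending the chain-homotopy class of a chain map `f : P ⟶ Q` to the family
`(H_n f)_n` is a bijection onto the set of families of homomorphisms `H_n P ⟶ H_n Q`: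
it is injective on homotopy classes (maps equal on homology are homotopic) and surjective
(every family of maps on homology is realized by a chain map). -/
def HomologyFullFaithful (R : Type u) [Ring R]
    (P Q : ChainComplex (ModuleCat.{u} Rᵐᵒᵖ) ℤ) : Prop :=
  (∀ f g : P ⟶ Q, (∀ n : ℤ, homologyMap f n = homologyMap g n) → Nonempty (Homotopy f g)) ∧
    ∀ φ : ∀ n : ℤ, P.homology n ⟶ Q.homology n, ∃ f : P ⟶ Q, ∀ n : ℤ, homologyMap f n = φ n

section Modules

variable {S : Type u} [Ring S]

/-- Zelmanowitz regularity of a module. -/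
def GoodModule (S : Type u) [Ring S] (M : Type u) [AddCommGroup M] [Module S M] : Prop :=
  ∀ m : M, ∃ φ : M →ₗ[S] S, φ m • m = m

lemma GoodModule.self (hS : ∀ x : S, ∃ y : S, x = x * y * x) : GoodModule S S := by
  intro m
  obtain ⟨y, hy⟩ := hS m
  exact ⟨LinearMap.toSpanSingleton S S y, by simpa using hy.symm⟩

lemma GoodModule.prod {M N : Type u} [AddCommGroup M] [Module S M] [AddCommGroup N] [Module S N]
    (hM : GoodModule S M) (hN : GoodModule S N) : GoodModule S (M × N) := by
  rintro ⟨a, b⟩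
  obtain ⟨φ, hφ⟩ := hM a
  obtain ⟨ψ, hψ⟩ := hN (b - φ a • b)
  let α : M × N →ₗ[S] S := φ ∘ₗ LinearMap.fst S M N
  let β : M × N →ₗ[S] S :=
    ψ ∘ₗ (LinearMap.snd S M N - (LinearMap.toSpanSingleton S N b) ∘ₗ α)
  refine ⟨α + (LinearMap.toSpanSingleton S S (1 - φ a)) ∘ₗ β, ?_⟩
  have h1 : α (a, b) = φ a := rfl
  have h2 : β (a, b) = ψ (b - φ a • b) := rfl
  simp only [LinearMap.add_apply, LinearMap.comp_apply, h1, h2, LinearMap.toSpanSingleton_apply,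
    Prod.smul_mk, smul_eq_mul, add_smul, mul_smul, sub_smul, one_smul]
  rw [hφ]
  refine Prod.ext ?_ ?_
  · simp
  · change φ a • b + ψ (b - φ a • b) • (b - φ a • b) = b
    rw [hψ]
    abel

lemma GoodModule.of_injective {M N : Type u} [AddCommGroup M] [Module S M] [AddCommGroup N]
    [Module S N] (hN : GoodModule S N) (i : M →ₗ[S] N) (hi : Function.Injective i) :
    GoodModule S M := by
  intro m
  obtain ⟨φ, hφ⟩ := hN (i m)
  exact ⟨φ ∘ₗ i, hi (by simpa using hφ)⟩

lemma GoodModule.pi (hS : ∀ x : S, ∃ y : S, x = x * y * x) (n : ℕ) :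
    GoodModule S (Fin n → S) := by
  induction n with
  | zero => exact fun m => ⟨0, Subsingleton.elim _ _⟩
  | succ n ih =>
    exact ((GoodModule.self hS).prod ih).of_injective
      (Fin.consLinearEquiv S (fun _ : Fin (n + 1) => S)).symm.toLinearMap
      (Fin.consLinearEquiv S (fun _ : Fin (n + 1) => S)).symm.injective

lemma GoodModule.of_projective (hS : ∀ x : S, ∃ y : S, x = x * y * x)
    (M : Type u) [AddCommGroup M] [Module S M] [Module.Finite S M] [Module.Projective S M] :
    GoodModule S M := by
  obtain ⟨n, f, hf⟩ := Module.Finite.exists_fin' S M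
  obtain ⟨g, hg⟩ := Module.projective_lifting_property f LinearMap.id hf
  refine (GoodModule.pi hS n).of_injective g ?_
  exact Function.LeftInverse.injective (g := f) (fun x => LinearMap.congr_fun hg x)

lemma GoodModule.exists_proj {N : Type u} [AddCommGroup N] [Module S N] (hN : GoodModule S N)
    (s : Set N) (hs : s.Finite) :
    ∃ p : N →ₗ[S] N, (∀ x, p x ∈ Submodule.span S s) ∧ ∀ x ∈ Submodule.span S s, p x = x := by
  induction s, hs using Set.Finite.induction_on with
  | empty => exact ⟨0, by simp, by simp +contextual⟩
  | @insert x s _ _ ih =>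
    obtain ⟨p, hp1, hp2⟩ := ih
    obtain ⟨φ, hφ⟩ := hN (x - p x)
    have hle : Submodule.span S s ≤ Submodule.span S (insert x s) :=
      Submodule.span_mono (Set.subset_insert _ _)
    have hx : x ∈ Submodule.span S (insert x s) :=
      Submodule.subset_span (Set.mem_insert _ _)
    let q : N →ₗ[S] N :=
      p + (LinearMap.toSpanSingleton S N (x - p x)) ∘ₗ φ ∘ₗ (LinearMap.id - p)
    have hq : ∀ v, q v = p v + φ (v - p v) • (x - p x) := fun v => rfl
    refine ⟨q, fun v => ?_, fun v hv => ?_⟩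
    · rw [hq]
      exact add_mem (hle (hp1 v)) (Submodule.smul_mem _ _ (sub_mem hx (hle (hp1 x))))
    · induction hv using Submodule.span_induction with
      | mem y hy =>
        rcases hy with rfl | hy
        · rw [hq, hφ]; abel
        · rw [hq, hp2 y (Submodule.subset_span hy)]; simp
      | zero => simp
      | add y z _ _ hy hz => rw [map_add, hy, hz]
      | smul a y _ hy => rw [map_smul, hy]

lemma exists_quasi_inverse (hS : ∀ x : S, ∃ y : S, x = x * y * x)
    {M N : Type u} [AddCommGroup M] [Module S M] [AddCommGroup N] [Module S N]
    [Module.Finite S M] [Module.Finite S N] [Module.Projective S N] (f : M →ₗ[S] N) :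
    ∃ g : N →ₗ[S] M, f ∘ₗ g ∘ₗ f = f := by
  have hfg : (LinearMap.range f).FG := by
    rw [LinearMap.range_eq_map]
    exact Submodule.FG.map _ Module.Finite.fg_top
  obtain ⟨s, hs⟩ := hfg
  obtain ⟨p, hp1, hp2⟩ :=
    (GoodModule.of_projective hS N).exists_proj (s : Set N) s.finite_toSet
  rw [hs] at hp1 hp2
  let p' : N →ₗ[S] LinearMap.range f := p.codRestrict _ hp1
  have : Module.Projective S (LinearMap.range f) :=
    Module.Projective.of_split (LinearMap.range f).subtype p' (by
      ext x; exact hp2 x x.2)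
  obtain ⟨t, ht⟩ := Module.projective_lifting_property f.rangeRestrict LinearMap.id
    f.surjective_rangeRestrict
  refine ⟨t ∘ₗ p', ?_⟩
  ext x
  have h1 : f (t (p' (f x))) = (p' (f x) : N) :=
    congrArg Subtype.val (LinearMap.congr_fun ht (p' (f x)))
  exact h1.trans (hp2 _ ⟨x, rfl⟩)

end Modules

section Complexes

variable {C : Type*} [Category* C] [Abelian C]

lemma iCycles_f_pOpcycles {P Q : ChainComplex C ℤ} (f : P ⟶ Q) (n : ℤ) :
    P.homologyπ n ≫ homologyMap f n ≫ Q.homologyι n = P.iCycles n ≫ f.f n ≫ Q.pOpcycles n := by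
  rw [homologyι_naturality, homology_π_ι_assoc, p_opcyclesMap]

lemma split_faithful (P Q : ChainComplex C ℤ)
    (s : ∀ i j, P.X i ⟶ P.X j) (hs : ∀ i j, P.d i j ≫ s j i ≫ P.d i j = P.d i j)
    (t : ∀ i j, Q.X i ⟶ Q.X j) (ht : ∀ i j, Q.d i j ≫ t j i ≫ Q.d i j = Q.d i j)
    (f : P ⟶ Q) (hf : ∀ n, homologyMap f n = 0) :
    Nonempty (Homotopy f 0) := by
  have key : ∀ i : ℤ, (𝟙 _ - P.d i (i - 1) ≫ s (i - 1) i) ≫ f.f i ≫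
      (𝟙 _ - t i (i + 1) ≫ Q.d (i + 1) i) = 0 := by
    intro i
    have h1 : P.liftCycles (𝟙 _ - P.d i (i - 1) ≫ s (i - 1) i) (i - 1) (by simp)
        (by simp [Preadditive.sub_comp, hs]) ≫ P.iCycles i = _ := P.liftCycles_i _ _ _ _
    have h2 : Q.pOpcycles i ≫ Q.descOpcycles (𝟙 _ - t i (i + 1) ≫ Q.d (i + 1) i) (i + 1) (by simp)
        (by simp [Preadditive.comp_sub, ht]) = _ := Q.p_descOpcycles _ _ _ _
    have h3 := iCycles_f_pOpcycles f i
    rw [hf] at h3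
    rw [← h1, ← h2]
    simp only [Category.assoc]
    rw [reassoc_of% h3.symm]
    simp
  refine ⟨{
    hom := fun i j => if j = i + 1 then
      (𝟙 _ - P.d i (i - 1) ≫ s (i - 1) i) ≫ f.f i ≫ t i j +
        s i j ≫ f.f j ≫ (𝟙 _ - Q.d j i ≫ t i j) else 0
    zero := fun i j h => if_neg (fun h' => h (by simp [h']))
    comm := fun i => ?_ }⟩
  have e : i - 1 - 1 + 1 = i - 1 := by ring
  rw [dNext_eq _ (show (ComplexShape.down ℤ).Rel i (i - 1) by simp),
    prevD_eq _ (show (ComplexShape.down ℤ).Rel (i + 1) i by simp)]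
  rw [if_pos (by ring), if_pos rfl]
  have k := key i
  have hs' := hs i (i - 1)
  have ht1 := ht (i + 1) i
  have hc := f.comm i (i - 1)
  have hc' := f.comm_assoc i (i - 1) (t (i - 1) i)
  simp only [Preadditive.sub_comp, Preadditive.comp_sub, Preadditive.add_comp,
    Preadditive.comp_add, Category.id_comp, Category.comp_id, Category.assoc, ht1, zero_f,
    add_zero, P.d_comp_d_assoc, zero_comp, sub_zero] at k ⊢
  rw [hc', reassoc_of% hs']
  rw [← sub_eq_zero, ← k]
  abel

lemma split_full (P Q : ChainComplex C ℤ)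
    (s : ∀ i j, P.X i ⟶ P.X j) (hs : ∀ i j, P.d i j ≫ s j i ≫ P.d i j = P.d i j)
    (t : ∀ i j, Q.X i ⟶ Q.X j) (ht : ∀ i j, Q.d i j ≫ t j i ≫ Q.d i j = Q.d i j)
    (φ : ∀ n : ℤ, P.homology n ⟶ Q.homology n) :
    ∃ f : P ⟶ Q, ∀ n : ℤ, homologyMap f n = φ n := by
  let l : ∀ i : ℤ, P.X i ⟶ P.cycles i := fun i =>
    P.liftCycles (𝟙 _ - P.d i (i - 1) ≫ s (i - 1) i) (i - 1) (by simp)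
        (by simp [Preadditive.sub_comp, hs])
  let r : ∀ i : ℤ, Q.opcycles i ⟶ Q.X i := fun i =>
    Q.descOpcycles (𝟙 _ - t i (i + 1) ≫ Q.d (i + 1) i) (i + 1) (by simp)
        (by simp [Preadditive.comp_sub, ht])
  have hl : ∀ i, P.iCycles i ≫ l i = 𝟙 _ := fun i => by
    rw [← cancel_mono (P.iCycles i)]
    simp [l, Preadditive.comp_sub]
  have hr : ∀ i, r i ≫ Q.pOpcycles i = 𝟙 _ := fun i => by
    rw [← cancel_epi (Q.pOpcycles i)]
    simp [r, Preadditive.sub_comp]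
  have hdl : ∀ i j, P.d i j ≫ l j = P.toCycles i j := fun i j => by
    rw [← cancel_mono (P.iCycles j)]
    simp [l, Preadditive.comp_sub]
  have hrd : ∀ i j, r i ≫ Q.d i j = Q.fromOpcycles i j := fun i j => by
    rw [← cancel_epi (Q.pOpcycles i)]
    simp [r, Preadditive.sub_comp]
  refine ⟨{
    f := fun i => l i ≫ P.homologyπ i ≫ φ i ≫ Q.homologyι i ≫ r i
    comm' := fun i j _ => ?_ }, fun n => ?_⟩
  · simp only [Category.assoc, hrd]
    rw [reassoc_of% (hdl i j)]
    simp
  · rw [← cancel_epi (P.homologyπ n), ← cancel_mono (Q.homologyι n), Category.assoc,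
      iCycles_f_pOpcycles]
    simp only [Category.assoc, hr]
    rw [reassoc_of% (hl n)]
    simp

end Complexes

section Converse

variable {C : Type*} [Category* C] [Abelian C]

lemma quasi_inverse_of_homology {A B : C} [Projective B] (a : A ⟶ B)
    (hfull : ∀ φ : ∀ n : ℤ, (double a (c := ComplexShape.down ℤ) (i₀ := 1) (i₁ := 0)
        (by simp)).homology n ⟶ (double a (c := ComplexShape.down ℤ) (i₀ := 1) (i₁ := 0)
        (by simp)).homology n, ∃ f, ∀ n : ℤ, homologyMap f n = φ n)
    (hfaith : ∀ f : double a (c := ComplexShape.down ℤ) (i₀ := 1) (i₁ := 0)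
        (by simp) ⟶ (single C (ComplexShape.down ℤ) 1).obj A,
        (∀ n, homologyMap f n = 0) → Nonempty (Homotopy f 0)) :
    ∃ k : B ⟶ A, a ≫ k ≫ a = a := by
  have hrel : (ComplexShape.down ℤ).Rel 1 0 := by simp
  change ∀ φ : ∀ n : ℤ, (double a hrel).homology n ⟶ (double a hrel).homology n, _ at hfull
  change ∀ f : double a hrel ⟶ _, _ at hfaith
  obtain ⟨P, hP⟩ : ∃ P, P = double a hrel := ⟨_, rfl⟩
  have hd : ∃ (e₁ : P.X 1 ≅ A) (e₀ : P.X 0 ≅ B), P.d 1 0 = e₁.hom ≫ a ≫ e₀.inv := by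
    subst hP
    exact ⟨_, _, double_d a hrel (by simp)⟩
  have hd21 : P.d 2 1 = 0 := by
    subst hP; exact double_d_eq_zero₀ _ _ _ _ (by simp)
  have hd0 : P.d 0 (-1) = 0 := by
    subst hP; exact double_d_eq_zero₀ _ _ _ _ (by simp)
  rw [← hP] at hfull hfaith
  clear hP
  obtain ⟨e₁, e₀, hd⟩ := hd
  obtain ⟨f, hf⟩ := hfull (fun n => if n = 0 then 𝟙 _ else 0)
  have hf1 : P.iCycles 1 ≫ f.f 1 = 0 := by
    have h := homologyπ_naturality f 1
    rw [hf 1, if_neg (by simp), comp_zero] at h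
    have := P.isIso_homologyπ 2 1 (by simp) hd21
    have h' : cyclesMap f 1 = 0 := by
      rw [← cancel_mono (P.homologyπ 1), ← h, zero_comp]
    rw [← cyclesMap_i, h', zero_comp]
  have hf0 : f.f 0 ≫ P.pOpcycles 0 = P.pOpcycles 0 := by
    have h := homologyι_naturality f 0
    rw [hf 0, if_pos rfl, Category.id_comp] at h
    have := P.isIso_homologyι 0 (-1) (by simp) hd0
    have h' : opcyclesMap f 0 = 𝟙 _ := by
      rw [← cancel_epi (P.homologyι 0), ← h, Category.comp_id]
    rw [← p_opcyclesMap, h', Category.comp_id]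
  have : Projective (P.X 0) := Projective.of_iso e₀.symm inferInstance
  obtain ⟨t, ht⟩ : ∃ t : P.X 0 ⟶ P.X 1, t ≫ P.d 1 0 = f.f 0 - 𝟙 _ := by
    have hex : (ShortComplex.mk (P.d 1 0) (P.pOpcycles 0) (by simp)).Exact :=
      ShortComplex.exact_of_g_is_cokernel _ (P.opcyclesIsCokernel 1 0 (by simp))
    exact ⟨_, hex.liftFromProjective_comp (f.f 0 - 𝟙 _) (by simp [Preadditive.sub_comp, hf0])⟩
  let g : P ⟶ (single C (ComplexShape.down ℤ) 1).obj A :=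
    mkHomToSingle (f.f 1 ≫ e₁.hom) (by
      intro i hi
      obtain rfl : i = 2 := by simp at hi; omega
      rw [hd21, zero_comp])
  have hg1 : g.f 1 = f.f 1 ≫ e₁.hom ≫ (singleObjXSelf (ComplexShape.down ℤ) 1 A).inv := by
    simp [g]
  obtain ⟨H⟩ := hfaith g (fun n => by
    have hc : P.iCycles n ≫ g.f n = 0 := by
      by_cases hn : n = 1
      · subst hn
        rw [hg1, reassoc_of% hf1, zero_comp]
      · exact (isZero_single_obj_X _ _ _ _ hn).eq_of_tgt _ _
    have hc' : cyclesMap g n = 0 := by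
      rw [← cancel_mono (iCycles _ n), cyclesMap_i, hc, zero_comp]
    rw [← cancel_epi (P.homologyπ n), homologyπ_naturality, hc', zero_comp, comp_zero])
  have hH := H.comm 1
  rw [dNext_eq _ hrel, prevD_eq _ (show (ComplexShape.down ℤ).Rel 2 1 by simp),
    (isZero_single_obj_X (ComplexShape.down ℤ) 1 A 2 (by simp)).eq_of_tgt (H.hom 1 2) 0, hg1]
    at hH
  simp only [zero_comp, add_zero, zero_f] at hH
  obtain ⟨h, hh⟩ : ∃ h : P.X 0 ⟶ P.X 1, f.f 1 = P.d 1 0 ≫ h :=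
    ⟨H.hom 0 1 ≫ (singleObjXSelf (ComplexShape.down ℤ) 1 A).hom ≫ e₁.inv, by
      rw [← reassoc_of% hH]; simp⟩
  have hcomm := f.comm 1 0
  have hf0' : f.f 0 = 𝟙 _ + t ≫ P.d 1 0 := by rw [ht]; abel
  rw [hh, hf0', Preadditive.comp_add, Category.comp_id, Category.assoc] at hcomm
  have hk : P.d 1 0 ≫ (h - t) ≫ P.d 1 0 = P.d 1 0 := by
    rw [Preadditive.sub_comp, Preadditive.comp_sub, hcomm]; abel
  rw [hd] at hk
  refine ⟨e₀.inv ≫ (h - t) ≫ e₁.hom, ?_⟩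
  rw [← cancel_mono e₀.inv, ← cancel_epi e₁.hom]
  simpa only [Category.assoc] using hk

end Converse

theorem strong_generating_hypothesis_iff_vonNeumannRegular (R : Type u) [Ring R] :
    (∀ P Q : ChainComplex (ModuleCat.{u} Rᵐᵒᵖ) ℤ, IsPerfect R P → IsPerfect R Q →
        HomologyFullFaithful R P Q) ↔
      ∀ x : R, ∃ y : R, x = x * y * x := by
  constructor
  · intro H x
    let A : ModuleCat.{u} Rᵐᵒᵖ := ModuleCat.of Rᵐᵒᵖ Rᵐᵒᵖ
    let a : A ⟶ A := ModuleCat.ofHom (LinearMap.toSpanSingleton Rᵐᵒᵖ Rᵐᵒᵖ (MulOpposite.op x))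
    have hz : ∀ X : ModuleCat.{u} Rᵐᵒᵖ, IsZero X →
        Module.Finite Rᵐᵒᵖ X ∧ Module.Projective Rᵐᵒᵖ X := fun X hX => by
      have := ModuleCat.subsingleton_of_isZero hX
      exact ⟨inferInstance, inferInstance⟩
    have hA : ∀ X : ModuleCat.{u} Rᵐᵒᵖ, (X ≅ A) →
        Module.Finite Rᵐᵒᵖ X ∧ Module.Projective Rᵐᵒᵖ X := fun X e =>
      ⟨Module.Finite.equiv (M := Rᵐᵒᵖ) e.symm.toLinearEquiv,
        Module.Projective.of_equiv (M := Rᵐᵒᵖ) e.symm.toLinearEquiv⟩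
    have hP : IsPerfect R (double a (c := ComplexShape.down ℤ) (i₀ := 1) (i₁ := 0)
        (by simp)) := by
      refine ⟨⟨0, 1, fun n hn => isZero_double_X _ _ _ (by omega) (by omega)⟩, fun n => ?_⟩
      by_cases h1 : n = 1
      · subst h1; exact hA _ (doubleXIso₀ _ _)
      by_cases h0 : n = 0
      · subst h0; exact hA _ (doubleXIso₁ _ _ (by simp))
      exact hz _ (isZero_double_X _ _ _ h1 h0)
    have hQ : IsPerfect R ((single (ModuleCat.{u} Rᵐᵒᵖ) (ComplexShape.down ℤ) 1).obj A) := by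
      refine ⟨⟨1, 1, fun n hn => isZero_single_obj_X _ _ _ _ (by omega)⟩, fun n => ?_⟩
      by_cases h1 : n = 1
      · subst h1; exact hA _ (singleObjXSelf _ _ _)
      exact hz _ (isZero_single_obj_X _ _ _ _ h1)
    have : Projective A := ModuleCat.projective_of_free (ι := Unit) (Module.Basis.singleton Unit Rᵐᵒᵖ)
    obtain ⟨k, hk⟩ := quasi_inverse_of_homology a (H _ _ hP hP).2
      (fun f hf => (H _ _ hP hQ).1 f 0 (fun n => by rw [hf n, homologyMap_zero]))
    let k' : Rᵐᵒᵖ →ₗ[Rᵐᵒᵖ] Rᵐᵒᵖ := k.hom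
    have h1 : k' ((1 : Rᵐᵒᵖ) • MulOpposite.op x) • MulOpposite.op x =
        (1 : Rᵐᵒᵖ) • MulOpposite.op x :=
      LinearMap.congr_fun (congrArg ModuleCat.Hom.hom hk) (1 : Rᵐᵒᵖ)
    have h2 : k' (MulOpposite.op x) = MulOpposite.op x * k' 1 := by
      rw [← smul_eq_mul, ← map_smul, smul_eq_mul, mul_one]
    rw [one_smul, h2] at h1
    refine ⟨(k' 1).unop, ?_⟩
    have h3 := congrArg MulOpposite.unop h1
    simp only [smul_eq_mul, MulOpposite.unop_mul, MulOpposite.unop_op] at h3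
    rw [mul_assoc]
    exact h3.symm
  · intro hR P Q hP hQ
    have hS : ∀ x : Rᵐᵒᵖ, ∃ y : Rᵐᵒᵖ, x = x * y * x := fun x => by
      obtain ⟨y, hy⟩ := hR x.unop
      refine ⟨MulOpposite.op y, MulOpposite.unop_injective ?_⟩
      simpa [mul_assoc] using hy
    have hsplit : ∀ P : ChainComplex (ModuleCat.{u} Rᵐᵒᵖ) ℤ, IsPerfect R P →
        ∃ s : ∀ i j, P.X i ⟶ P.X j, ∀ i j, P.d i j ≫ s j i ≫ P.d i j = P.d i j := by
      intro P hP
      have : ∀ j i, ∃ s : P.X j ⟶ P.X i, P.d i j ≫ s ≫ P.d i j = P.d i j := fun j i => by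
        have := (hP.2 i).1
        have := (hP.2 j).1
        have := (hP.2 j).2
        obtain ⟨g, hg⟩ := exists_quasi_inverse hS (P.d i j).hom
        exact ⟨ModuleCat.ofHom g, ModuleCat.hom_ext hg⟩
      choose s hs using this
      exact ⟨s, fun i j => hs j i⟩
    obtain ⟨s, hs⟩ := hsplit P hP
    obtain ⟨t, ht⟩ := hsplit Q hQ
    refine ⟨fun f g hfg => ?_, split_full P Q s hs t ht⟩
    obtain ⟨h⟩ := split_faithful P Q s hs t ht (f - g) (fun n => by
      rw [homologyMap_sub, hfg n, sub_self])
    exact ⟨Homotopy.equivSubZero.symm h⟩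
end

section
/- Let R be a commutative ring. Then R satisfies the generating hypothesis if and only if R satisfies the strong generating hypothesis. -/
open CategoryTheory CategoryTheory.Limits HomologicalComplex TensorProduct

universe u

/-- A chain complex of modules over a commutative ring `R` is perfect if it is bounded and
each term is a finitely generated projective module. -/
def IsPerfectC (R : Type u) [CommRing R] (P : ChainComplex (ModuleCat.{u} R) ℤ) : Prop :=
  (∃ a b : ℤ, ∀ n : ℤ, (n < a ∨ b < n) → IsZero (P.X n)) ∧
    ∀ n : ℤ, Module.Finite R (P.X n) ∧ Module.Projective R (P.X n)

/-- `R` satisfies the generating hypothesis: every chain map between perfect complexes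
which induces the zero map on all homology modules is chain homotopic to zero. -/
def SatisfiesGHC (R : Type u) [CommRing R] : Prop :=
  ∀ P Q : ChainComplex (ModuleCat.{u} R) ℤ, IsPerfectC R P → IsPerfectC R Q →
    ∀ f : P ⟶ Q, (∀ n : ℤ, homologyMap f n = 0) → Nonempty (Homotopy f 0)

/-- `R` satisfies the strong generating hypothesis: for all perfect complexes `P`, `Q`, the
map sending the chain-homotopy class of a chain map `f : P ⟶ Q` to `(H_n f)_n` is a
bijection onto the families of homomorphisms `H_n P ⟶ H_n Q`. -/
def SatisfiesStrongGHC (R : Type u) [CommRing R] : Prop :=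
  ∀ P Q : ChainComplex (ModuleCat.{u} R) ℤ, IsPerfectC R P → IsPerfectC R Q →
    (∀ f g : P ⟶ Q, (∀ n : ℤ, homologyMap f n = homologyMap g n) → Nonempty (Homotopy f g)) ∧
      ∀ φ : ∀ n : ℤ, P.homology n ⟶ Q.homology n, ∃ f : P ⟶ Q, ∀ n : ℤ, homologyMap f n = φ n

theorem GHaux.flat {R : Type u} [CommRing R] (h : ∀ x : R, ∃ a, x = x * x * a)
    (M : Type u) [AddCommGroup M] [Module R M] : Module.Flat R M := by
  rw [Module.Flat.iff_rTensor_injective]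
  intro I hI
  have hid : IsIdempotentElem I := by
    refine le_antisymm Ideal.mul_le_left fun x hx => ?_
    obtain ⟨a, ha⟩ := h x
    rw [ha]
    exact Ideal.mul_mem_right _ _ (Ideal.mul_mem_mul hx hx)
  obtain ⟨e, he, rfl⟩ := (Ideal.isIdempotentElem_iff_of_fg I hI).1 hid
  let r : R →ₗ[R] (Ideal.span {e} : Ideal R) :=
    LinearMap.codRestrict _ (LinearMap.mulLeft R e)
      (fun x => Ideal.mul_mem_right _ _ (Ideal.mem_span_singleton_self e))
  have hr : r ∘ₗ (Ideal.span {e} : Ideal R).subtype = LinearMap.id := by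
    ext ⟨x, hx⟩
    obtain ⟨y, rfl⟩ := Ideal.mem_span_singleton'.1 hx
    change e * (y * e) = y * e
    rw [mul_left_comm, he.eq]
  refine Function.LeftInverse.injective (g := r.rTensor M) fun x => ?_
  rw [← LinearMap.comp_apply]
  erw [← LinearMap.rTensor_comp]
  rw [hr]; simp

theorem GHaux.regular {R : Type u} [CommRing R] (h : ∀ x : R, ∃ a, x = x * x * a)
    {M N : Type u} [AddCommGroup M] [Module R M] [AddCommGroup N] [Module R N]
    [Module.Finite R M] [Module.Finite R N]
    [Module.Projective R N] (d : M →ₗ[R] N) :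
    ∃ t : N →ₗ[R] M, d ∘ₗ t ∘ₗ d = d := by
  have : Module.FinitePresentation R N := Module.finitePresentation_of_projective _ _
  have hfg : (LinearMap.range d).FG := by
    rw [LinearMap.range_eq_map]; exact Submodule.FG.map _ Module.Finite.fg_top
  have : Module.FinitePresentation R (N ⧸ LinearMap.range d) :=
    Module.finitePresentation_of_surjective (Submodule.mkQ _) (Submodule.mkQ_surjective _)
      (by rwa [Submodule.ker_mkQ])
  have := GHaux.flat h (N ⧸ LinearMap.range d)
  have : Module.Projective R (N ⧸ LinearMap.range d) :=
    Module.Flat.projective_of_finitePresentation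
  obtain ⟨s, hs⟩ := Module.projective_lifting_property (LinearMap.range d).mkQ LinearMap.id
    (Submodule.mkQ_surjective _)
  let ρ : N →ₗ[R] LinearMap.range d := LinearMap.codRestrict _
    (LinearMap.id - s ∘ₗ (LinearMap.range d).mkQ) (fun x => by
      rw [← Submodule.Quotient.mk_eq_zero, ← Submodule.mkQ_apply]
      have := LinearMap.congr_fun hs ((LinearMap.range d).mkQ x)
      simp only [LinearMap.comp_apply, LinearMap.id_apply] at this
      rw [LinearMap.sub_apply, map_sub, LinearMap.comp_apply, this]; simp)
  have hρ : ∀ x, (ρ (d x) : N) = d x := fun x => by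
    change d x - s ((LinearMap.range d).mkQ (d x)) = d x
    have : (LinearMap.range d).mkQ (d x) = 0 := by simp
    rw [this]; simp
  have : Module.Projective R (LinearMap.range d) :=
    Module.Projective.of_split (LinearMap.range d).subtype ρ (by
      ext ⟨_, x, rfl⟩
      exact hρ x)
  obtain ⟨t, ht⟩ := Module.projective_lifting_property d.rangeRestrict LinearMap.id
    d.surjective_rangeRestrict
  refine ⟨t ∘ₗ ρ, ?_⟩
  ext x
  have := congrArg Subtype.val (LinearMap.congr_fun ht (ρ (d x)))
  simp only [LinearMap.comp_apply, LinearMap.id_apply] at this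
  exact this.trans (hρ x)

/-- splitting data -/
theorem GHaux.split {R : Type u} [CommRing R] (P : ChainComplex (ModuleCat.{u} R) ℤ)
    (t : ∀ i j : ℤ, P.X i ⟶ P.X j)
    (ht : ∀ i j : ℤ, P.d j i ≫ t i j ≫ P.d j i = P.d j i)
    (ht0 : ∀ i j : ℤ, i + 1 ≠ j → t i j = 0) :
    ∃ (r : ∀ n, P.X n ⟶ P.homology n) (σ : ∀ n, P.homology n ⟶ P.X n) (e : P ⟶ P),
      (∀ i j, P.d i j ≫ r j = 0) ∧ (∀ i j, σ i ≫ P.d i j = 0) ∧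
      (∀ n, e.f n = r n ≫ σ n) ∧ Nonempty (Homotopy e (𝟙 P)) ∧
      (∀ n, P.iCycles n ≫ r n = P.homologyπ n) ∧
      (∀ n, ∃ w, P.homologyπ n ≫ σ n = P.iCycles n - w ≫ P.d (n + 1) n) := by
  have hnext : ∀ n : ℤ, (ComplexShape.down ℤ).next n = n - 1 := fun n =>
    ComplexShape.next_eq' _ (by simp)
  have hprev : ∀ n : ℤ, (ComplexShape.down ℤ).prev n = n + 1 := fun n =>
    ComplexShape.prev_eq' _ (by simp)
  have hz : ∀ n, (𝟙 (P.X n) - P.d n (n-1) ≫ t (n-1) n) ≫ P.d n (n-1) = 0 := fun n => by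
    simp [ht]
  let z : ∀ n, P.X n ⟶ P.cycles n := fun n =>
    P.liftCycles (𝟙 (P.X n) - P.d n (n-1) ≫ t (n-1) n) (n-1) (hnext n) (hz n)
  have hzi : ∀ n, z n ≫ P.iCycles n = 𝟙 (P.X n) - P.d n (n-1) ≫ t (n-1) n := fun n => by
    simp [z]
  have hiz : ∀ n, P.iCycles n ≫ z n = 𝟙 _ := fun n => by
    rw [← cancel_mono (P.iCycles n)]; simp [hzi]
  have hdz : ∀ i j, P.d i j ≫ z j = P.toCycles i j := fun i j => by
    rw [← cancel_mono (P.iCycles j)]; simp [hzi]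
  have hσ : ∀ n, ∃ s : P.homology n ⟶ P.X n, P.homologyπ n ≫ s =
      P.iCycles n - (P.iCycles n ≫ t n (n+1)) ≫ P.d (n + 1) n := fun n => by
    have h0 : P.toCycles (n+1) n ≫ 
      (P.iCycles n - (P.iCycles n ≫ t n (n+1)) ≫ P.d (n + 1) n) = 0 := by
      simp [ht]
    exact ⟨(P.homologyIsCokernel (n+1) n (hprev n)).desc (CokernelCofork.ofπ _ h0),
      (P.homologyIsCokernel (n+1) n (hprev n)).fac (CokernelCofork.ofπ _ h0)
        WalkingParallelPair.one⟩
  choose σ hσ using hσ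
  have hr0 : ∀ i j, P.d i j ≫ z j ≫ P.homologyπ j = 0 := fun i j => by
    rw [reassoc_of% (hdz i j)]; simp
  have hσ0 : ∀ i j, σ i ≫ P.d i j = 0 := fun i j => by
    rw [← cancel_epi (P.homologyπ i), reassoc_of% (hσ i)]; simp
  refine ⟨fun n => z n ≫ P.homologyπ n, σ,
    { f := fun n => z n ≫ P.homologyπ n ≫ σ n
      comm' := fun i j _ => ?_ }, hr0, hσ0, fun n => by simp, ⟨?_⟩, fun n => ?_,
      fun n => ⟨_, hσ n⟩⟩
  · have := hr0 i j
    simp only [Category.assoc, hσ0]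
    rw [reassoc_of% (hdz i j)]; simp
  · refine 
      { hom := fun i j => (P.d i (i-1) ≫ t (i-1) i - 𝟙 (P.X i)) ≫ t i j
        zero := fun i j hij => by
          rw [ht0 i j (by simpa using hij)]; simp
        comm := fun n => ?_ }
    rw [dNext_eq _ (show (ComplexShape.down ℤ).Rel n (n-1) by simp),
      prevD_eq _ (show (ComplexShape.down ℤ).Rel (n+1) n by simp)]
    simp only [hσ, Preadditive.comp_sub, Preadditive.sub_comp, Category.assoc, hzi,
      reassoc_of% (hzi n), HomologicalComplex.id_f, Category.id_comp,
      HomologicalComplex.d_comp_d_assoc, zero_comp]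
    abel
  · rw [reassoc_of% (hiz n)]

theorem GHaux.strong {R : Type u} [CommRing R] (h : ∀ x : R, ∃ a, x = x * x * a) :
    SatisfiesStrongGHC R := by
  have key : ∀ P : ChainComplex (ModuleCat.{u} R) ℤ, IsPerfectC R P → ∃ t : ∀ i j : ℤ, P.X i ⟶ P.X j,
    (∀ i j : ℤ, P.d j i ≫ t i j ≫ P.d j i = P.d j i) ∧
    (∀ i j : ℤ, i + 1 ≠ j → t i j = 0) := by
    intro P hP
    have : ∀ i j : ℤ, ∃ t : P.X i ⟶ P.X j, P.d j i ≫ t ≫ P.d j i = P.d j i ∧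
        (i + 1 ≠ j → t = 0) := by
      intro i j
      by_cases hij : i + 1 = j
      · have := (hP.2 i).1
        have := (hP.2 i).2
        have := (hP.2 j).1
        obtain ⟨t, ht⟩ := GHaux.regular h (P.d j i).hom
        refine ⟨ModuleCat.ofHom t, ?_, fun h => absurd hij h⟩
        ext x
        exact LinearMap.congr_fun ht x
      · refine ⟨0, ?_, fun _ => rfl⟩
        rw [P.shape _ _ (by simpa using hij)]; simp
    choose t ht using this
    exact ⟨t, fun i j => (ht i j).1, fun i j => (ht i j).2⟩
  intro P Q hP hQ
  obtain ⟨t, ht, ht0⟩ := key P hP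
  obtain ⟨r, σ, e, hr, hσ, he, ⟨H⟩, hir, hw⟩ := GHaux.split P t ht ht0
  obtain ⟨t', ht', ht0'⟩ := key Q hQ
  obtain ⟨r', σ', e', hr', hσ', he', ⟨H'⟩, hir', hw'⟩ := GHaux.split Q t' ht' ht0'
  have hmap : ∀ (f : P ⟶ Q) n, σ n ≫ f.f n ≫ r' n = homologyMap f n := by
    intro f n
    obtain ⟨w, hw⟩ := hw n
    rw [← cancel_epi (P.homologyπ n), reassoc_of% hw, Preadditive.sub_comp, Category.assoc,
      ← f.comm_assoc, hr', homologyπ_naturality, ← hir', cyclesMap_i_assoc]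
    simp
  have hσr' : ∀ n, σ' n ≫ r' n = 𝟙 _ := fun n => by
    obtain ⟨w, hw⟩ := hw' n
    rw [← cancel_epi (Q.homologyπ n), reassoc_of% hw, Preadditive.sub_comp, Category.assoc,
      hr', hir']
    simp
  have hσr : ∀ n, σ n ≫ r n = 𝟙 _ := fun n => by
    obtain ⟨w, hw⟩ := hw n
    rw [← cancel_epi (P.homologyπ n), reassoc_of% hw, Preadditive.sub_comp, Category.assoc,
      hr, hir]
    simp
  constructor
  · intro f g hfg
    have hom : ∀ f : P ⟶ Q, Nonempty (Homotopy (e ≫ f ≫ e') f) := fun f =>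
      ⟨(H.comp (H'.compLeft f)).trans (Homotopy.ofEq (by simp))⟩
    obtain ⟨hf⟩ := hom f
    obtain ⟨hg⟩ := hom g
    refine ⟨hf.symm.trans ((Homotopy.ofEq ?_).trans hg)⟩
    ext1 n
    simp only [HomologicalComplex.comp_f, he, he', Category.assoc]
    have := (hmap f n).trans ((hfg n).trans (hmap g n).symm)
    have := congrArg (fun q => r n ≫ q ≫ σ' n) this
    simpa only [Category.assoc] using this
  · intro φ
    refine ⟨{ f := fun n => r n ≫ φ n ≫ σ' n
              comm' := fun i j _ => by
                simp [hσ', reassoc_of% (hr i j)] }, fun n => ?_⟩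
    rw [← hmap]
    simp [hσr', reassoc_of% (hσr n)]

/-- The ring `R` in degrees satisfying `p`, zero elsewhere. -/
abbrev GHaux.sub (R : Type u) [CommRing R] (a b n : ℤ) : Submodule R R :=
  if a ≤ n ∧ n ≤ b then ⊤ else ⊥

theorem GHaux.mem_sub {R : Type u} [CommRing R] {a b n : ℤ} (h : a ≤ n ∧ n ≤ b) (x : R) :
    x ∈ GHaux.sub R a b n := by
  simp [GHaux.sub, h]

theorem GHaux.sub_zero {R : Type u} [CommRing R] {a b n : ℤ} (h : ¬ (a ≤ n ∧ n ≤ b))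
    (x : GHaux.sub R a b n) : (x : R) = 0 := by
  obtain ⟨x, hx⟩ := x
  rw [GHaux.sub, if_neg h] at hx
  simpa using hx

/-- Multiplication by `c` on the degreewise copies of `R`. -/
def GHaux.mulMap {R : Type u} [CommRing R] (a b i a' b' j : ℤ) (c : R)
    (h : c ≠ 0 → a' ≤ j ∧ j ≤ b') :
    GHaux.sub R a b i →ₗ[R] GHaux.sub R a' b' j :=
  LinearMap.codRestrict _ (LinearMap.mulLeft R c ∘ₗ Submodule.subtype _) (fun x => by
    by_cases hc : c = 0
    · simp [hc]
    · exact GHaux.mem_sub (h hc) _)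

theorem GHaux.mulMap_apply {R : Type u} [CommRing R] (a b i a' b' j : ℤ) (c : R)
    (h : c ≠ 0 → a' ≤ j ∧ j ≤ b') (x : GHaux.sub R a b i) :
    (GHaux.mulMap a b i a' b' j c h x : R) = c * x := rfl

/-- The complex with `R` in degrees `a, ..., b` and all differentials equal to `x`. -/
def GHaux.cplx {R : Type u} [CommRing R] (a b : ℤ) (x : R) (hx : x * x = 0 ∨ b ≤ a + 1) :
    ChainComplex (ModuleCat.{u} R) ℤ where
  X n := ModuleCat.of R (GHaux.sub R a b n)
  d i j := ModuleCat.ofHom (GHaux.mulMap a b i a b j (if j + 1 = i ∧ a ≤ j ∧ i ≤ b then x else 0)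
    (fun h => by
      by_contra h'
      exact h (if_neg (by omega))))
  shape i j h := by
    refine ModuleCat.hom_ext (LinearMap.ext fun (y : GHaux.sub R a b i) => ?_)
    apply Subtype.ext
    have : ¬ (j + 1 = i) := by simpa using h
    change (if j + 1 = i ∧ a ≤ j ∧ i ≤ b then x else 0) * (y : R) = 0
    rw [if_neg (by tauto)]; simp
  d_comp_d' i j k hij hjk := by
    refine ModuleCat.hom_ext (LinearMap.ext fun (y : GHaux.sub R a b i) => ?_)
    apply Subtype.ext
    change (if k + 1 = j ∧ a ≤ k ∧ j ≤ b then x else 0) *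
      ((if j + 1 = i ∧ a ≤ j ∧ i ≤ b then x else 0) * (y : R)) = 0
    split_ifs
    · rcases hx with hx | hx
      · rw [← mul_assoc, hx, zero_mul]
      · omega
    all_goals simp

theorem GHaux.cplx_d {R : Type u} [CommRing R] (a b : ℤ) (x : R) (hx : x * x = 0 ∨ b ≤ a + 1)
    (i j : ℤ) (y : GHaux.sub R a b i) :
    (show GHaux.sub R a b j from ((GHaux.cplx a b x hx).d i j).hom y : R) =
      (if j + 1 = i ∧ a ≤ j ∧ i ≤ b then x else 0) * y := rfl

theorem GHaux.cplx_perfect {R : Type u} [CommRing R] (a b : ℤ) (x : R)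
    (hx : x * x = 0 ∨ b ≤ a + 1) : IsPerfectC R (GHaux.cplx a b x hx) := by
  refine ⟨⟨a, b, fun n hn => ?_⟩, fun n => ?_⟩
  · have : Subsingleton (GHaux.sub R a b n) := ⟨fun y z => Subtype.ext (by
      rw [GHaux.sub_zero (by omega) y, GHaux.sub_zero (by omega) z])⟩
    exact ModuleCat.isZero_of_subsingleton (ModuleCat.of R (GHaux.sub R a b n))
  · change Module.Finite R (GHaux.sub R a b n) ∧ Module.Projective R (GHaux.sub R a b n)
    by_cases h : a ≤ n ∧ n ≤ b
    · rw [GHaux.sub, if_pos h]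
      exact ⟨Module.Finite.equiv Submodule.topEquiv.symm,
        Module.Projective.of_equiv Submodule.topEquiv.symm⟩
    · rw [GHaux.sub, if_neg h]
      exact ⟨inferInstance, inferInstance⟩

/-- Multiplication by `r` in degrees `lo, ..., hi`. -/
def GHaux.cmap {R : Type u} [CommRing R] (a b a' b' lo hi : ℤ) (x r : R)
    (hx : x * x = 0 ∨ b ≤ a + 1) (hx' : x * x = 0 ∨ b' ≤ a' + 1)
    (h1 : a' ≤ lo) (h2 : hi ≤ b')
    (h3 : ∀ j, a ≤ j ∧ j + 1 ≤ b → (lo ≤ j ∧ j ≤ hi) → a' ≤ j ∧ j + 1 ≤ b' ∧ lo ≤ j + 1 ∧ j + 1 ≤ hi)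
    (h4 : ∀ j, a' ≤ j ∧ j + 1 ≤ b' → (lo ≤ j + 1 ∧ j + 1 ≤ hi) → 
      (a ≤ j ∧ j + 1 ≤ b ∧ lo ≤ j ∧ j ≤ hi) ∨ ¬ (a ≤ j + 1 ∧ j + 1 ≤ b)) :
    GHaux.cplx a b x hx ⟶ GHaux.cplx a' b' x hx' where
  f n := ModuleCat.ofHom (GHaux.mulMap a b n a' b' n (if lo ≤ n ∧ n ≤ hi then r else 0)
    (fun h => by
      by_contra h'
      exact h (if_neg (by omega))))
  comm' i j hij := by
    have hij : j + 1 = i := by simpa using hij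
    subst hij
    refine ModuleCat.hom_ext (LinearMap.ext fun (y : GHaux.sub R a b (j + 1)) => ?_)
    apply Subtype.ext
    change (if j + 1 = j + 1 ∧ a' ≤ j ∧ j + 1 ≤ b' then x else 0) *
      ((if lo ≤ j + 1 ∧ j + 1 ≤ hi then r else 0) * (y : R)) =
      (if lo ≤ j ∧ j ≤ hi then r else 0) *
      ((if j + 1 = j + 1 ∧ a ≤ j ∧ j + 1 ≤ b then x else 0) * (y : R))
    have h3 := h3 j
    have h4 := h4 j
    by_cases hy : a ≤ j + 1 ∧ j + 1 ≤ b
    · split_ifs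
      all_goals first | (ring; done) | (exfalso; omega)
    · rw [GHaux.sub_zero hy y]; simp

theorem GHaux.homologyMap_zero {R : Type u} [CommRing R] {P Q : ChainComplex (ModuleCat.{u} R) ℤ}
    (f : P ⟶ Q) (n : ℤ)
    (h : ∀ z : P.X n, (P.d n (n-1)).hom z = 0 → ∃ w : Q.X (n+1), (Q.d (n+1) n).hom w = (f.f n).hom z) :
    homologyMap f n = 0 := by
  rw [← cancel_epi (P.homologyπ n), homologyπ_naturality]
  ext c
  obtain ⟨w, hw⟩ := h ((P.iCycles n).hom c) (by
    rw [← LinearMap.comp_apply, ← ModuleCat.hom_comp, iCycles_d]; rfl)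
  have h1 : (cyclesMap f n).hom c = (Q.toCycles (n+1) n).hom w := by
    apply (ModuleCat.mono_iff_injective (Q.iCycles n)).1 inferInstance
    change (cyclesMap f n ≫ Q.iCycles n).hom c = (Q.toCycles (n+1) n ≫ Q.iCycles n).hom w
    rw [cyclesMap_i, toCycles_i, hw]; rfl
  change (Q.homologyπ n).hom ((cyclesMap f n).hom c) = _
  rw [h1]
  change (Q.toCycles (n+1) n ≫ Q.homologyπ n).hom w = _
  rw [toCycles_comp_homologyπ]; simp

/-- The value at `1` of the component of a homotopy. -/
theorem GHaux.homotopy_eval {R : Type u} [CommRing R] (a b a' b' lo hi : ℤ) (x r : R)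
    (hx : x * x = 0 ∨ b ≤ a + 1) (hx' : x * x = 0 ∨ b' ≤ a' + 1)
    (h1 h2 h3 h4)
    (H : Homotopy (GHaux.cmap a b a' b' lo hi x r hx hx' h1 h2 h3 h4) 0) :
    ∃ s : ℤ → R, (∀ n, ¬ (a ≤ n ∧ n ≤ b ∧ a' ≤ n + 1 ∧ n + 1 ≤ b') → s n = 0) ∧
      ∀ n, a ≤ n ∧ n ≤ b → lo ≤ n ∧ n ≤ hi →
      r = (if a ≤ n - 1 then s (n - 1) else 0) * x + x * s n := by
  classical
  let h : ∀ i j : ℤ, GHaux.sub R a b i →ₗ[R] GHaux.sub R a' b' j := fun i j => (H.hom i j).hom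
  let s : ℤ → R := fun n => if hn : a ≤ n ∧ n ≤ b then
    (h n (n+1) ⟨1, GHaux.mem_sub hn 1⟩ : R) else 0
  refine ⟨s, fun n hn => ?_, fun n hn hn' => ?_⟩
  · by_cases hn' : a ≤ n ∧ n ≤ b
    · simp only [s, dif_pos hn']
      exact GHaux.sub_zero (by omega) _
    · simp only [s, dif_neg hn']
  have hc := H.comm n
  rw [dNext_eq _ (show (ComplexShape.down ℤ).Rel n (n-1) by simp),
      prevD_eq _ (show (ComplexShape.down ℤ).Rel (n+1) n by simp)] at hc
  have hc' := congrArg (fun g => ((show GHaux.sub R a' b' n from g.hom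
    (show GHaux.sub R a b n from ⟨1, GHaux.mem_sub hn 1⟩)) : R)) hc
  replace hc' : (if lo ≤ n ∧ n ≤ hi then r else 0) * 1 =
    (h (n-1) n (GHaux.mulMap a b n a b (n-1)
      (if n - 1 + 1 = n ∧ a ≤ n - 1 ∧ n ≤ b then x else 0) (fun h => by
      by_contra h'
      exact h (if_neg (by omega))) ⟨1, GHaux.mem_sub hn 1⟩) : R) +
    (if n + 1 = n + 1 ∧ a' ≤ n ∧ n + 1 ≤ b' then x else 0) *
      (h n (n+1) ⟨1, GHaux.mem_sub hn 1⟩ : R) + 0 := hc'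
  rw [if_pos hn', mul_one, add_zero] at hc'
  rw [hc']
  congr 1
  · by_cases ha : a ≤ n - 1
    · rw [if_pos ha]
      have : GHaux.mulMap a b n a b (n-1)
        (if n - 1 + 1 = n ∧ a ≤ n - 1 ∧ n ≤ b then x else 0) (fun h => by
          by_contra h'
          exact h (if_neg (by omega))) ⟨1, GHaux.mem_sub hn 1⟩ = 
          x • (⟨1, GHaux.mem_sub (by omega) 1⟩ : GHaux.sub R a b (n-1)) := by
        apply Subtype.ext
        rw [GHaux.mulMap_apply, if_pos (by omega)]; rfl
      rw [this, map_smul]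
      simp only [s]
      rw [dif_pos (by omega)]
      have hn1 : n - 1 + 1 = n := by omega
      rw [Submodule.coe_smul, smul_eq_mul, mul_comm]
      congr 2
      all_goals (try rw [hn1])
    · rw [if_neg ha]
      have : GHaux.mulMap a b n a b (n-1)
        (if n - 1 + 1 = n ∧ a ≤ n - 1 ∧ n ≤ b then x else 0) (fun h => by
          by_contra h'
          exact h (if_neg (by omega))) ⟨1, GHaux.mem_sub hn 1⟩ = 0 := by
        apply Subtype.ext
        rw [GHaux.mulMap_apply, if_neg (by omega)]; simp
      rw [this]; simp
  · simp only [s, dif_pos hn]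
    by_cases hh : n + 1 = n + 1 ∧ a' ≤ n ∧ n + 1 ≤ b'
    · rw [if_pos ⟨trivial, hh.2⟩]
    · rw [GHaux.sub_zero (by omega) (h n (n+1) _)]; simp

theorem GHaux.reduced {R : Type u} [CommRing R] (h : SatisfiesGHC R) (x : R) (hx : x * x = 0) :
    x = 0 := by
  obtain ⟨H⟩ := h (GHaux.cplx 0 2 x (.inl hx)) (GHaux.cplx 0 2 x (.inl hx))
    (GHaux.cplx_perfect _ _ _ _) (GHaux.cplx_perfect _ _ _ _)
    (GHaux.cmap 0 2 0 2 0 2 x x (.inl hx) (.inl hx) (by omega) (by omega) (by omega) (by omega))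
    (fun n => GHaux.homologyMap_zero _ _ (fun (z : GHaux.sub R 0 2 n) hz => by
      replace hz : (if n - 1 + 1 = n ∧ 0 ≤ n - 1 ∧ n ≤ 2 then x else 0) * (z : R) = 0 :=
        congrArg (fun y : GHaux.sub R 0 2 (n-1) => (y : R)) hz
      by_cases h0 : n = 0
      · subst h0
        refine ⟨(⟨z, GHaux.mem_sub (by omega) _⟩ : GHaux.sub R 0 2 (0+1)), ?_⟩
        apply Subtype.ext
        change (if (0:ℤ) + 1 = 0 + 1 ∧ (0:ℤ) ≤ 0 ∧ (0:ℤ) + 1 ≤ 2 then x else 0) * (z : R) =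
          (if (0:ℤ) ≤ 0 ∧ (0:ℤ) ≤ 2 then x else 0) * (z : R)
        norm_num
      · refine ⟨0, ?_⟩
        rw [map_zero]
        apply Subtype.ext
        change 0 = (if (0:ℤ) ≤ n ∧ n ≤ 2 then x else 0) * (z : R)
        split_ifs with h1
        · rw [if_pos (by omega)] at hz
          exact hz.symm
        · simp))
  obtain ⟨s, hs0, hs⟩ := GHaux.homotopy_eval _ _ _ _ _ _ _ _ _ _ _ _ _ _ H
  have e0 := hs 0 (by omega) (by omega)
  have e1 := hs 1 (by omega) (by omega)
  have e2 := hs 2 (by omega) (by omega)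
  rw [if_neg (by omega)] at e0
  rw [if_pos (by omega), show (1:ℤ) - 1 = 0 by norm_num] at e1
  rw [if_pos (by omega), show (2:ℤ) - 1 = 1 by norm_num, hs0 2 (by omega)] at e2
  linear_combination e0 + e2 - e1

theorem GHaux.vnr {R : Type u} [CommRing R] (h : SatisfiesGHC R) (x : R) :
    ∃ a, x = x * x * a := by
  obtain ⟨H⟩ := h (GHaux.cplx 0 1 (x * x) (.inr (by omega))) (GHaux.cplx 1 2 (x * x) (.inr (by omega)))
    (GHaux.cplx_perfect _ _ _ _) (GHaux.cplx_perfect _ _ _ _)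
    (GHaux.cmap 0 1 1 2 1 1 (x * x) x (.inr (by omega)) (.inr (by omega))
      (by omega) (by omega) (by omega) (by omega))
    (fun n => GHaux.homologyMap_zero _ _ (fun (z : GHaux.sub R 0 1 n) hz => by
      replace hz : (if n - 1 + 1 = n ∧ 0 ≤ n - 1 ∧ n ≤ 1 then x * x else 0) * (z : R) = 0 :=
        congrArg (fun y : GHaux.sub R 0 1 (n-1) => (y : R)) hz
      refine ⟨0, ?_⟩
      rw [map_zero]
      apply Subtype.ext
      change 0 = (if (1:ℤ) ≤ n ∧ n ≤ 1 then x else 0) * (z : R)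
      split_ifs with h1
      · rw [if_pos (by omega)] at hz
        exact (GHaux.reduced h _ (by linear_combination (z : R) * hz)).symm
      · simp))
  obtain ⟨s, hs0, hs⟩ := GHaux.homotopy_eval _ _ _ _ _ _ _ _ _ _ _ _ _ _ H
  have e1 := hs 1 (by omega) (by omega)
  exact ⟨_, e1.trans (by rw [mul_comm, ← mul_add])⟩

theorem generating_hypothesis_iff_strong_generating_hypothesis_of_commutative
    (R : Type u) [CommRing R] :
    SatisfiesGHC R ↔ SatisfiesStrongGHC R := by
  constructor
  · intro h
    exact GHaux.strong (GHaux.vnr h)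
  · intro h P Q hP hQ f hf
    exact (h P Q hP hQ).1 f 0 (fun n => by rw [hf n, homologyMap_zero])
end

section
/- A ring R is von Neumann regular if and only if every right R-module is FP-injective; that is, for every x in R there exists y with x = xyx, if and only if Ext^1_R(F, M) = 0 for every finitely presented right R-module F and every right R-module M. -/
open CategoryTheory CategoryTheory.Limits HomologicalComplex TensorProduct

universe u

/-- A right `R`-module `M` is FP-injective if `Ext¹_R(F, M) = 0` for every finitely
presented right `R`-module `F`. -/
def FPInjective (R : Type u) [Ring R] [HasExt.{u} (ModuleCat.{u} Rᵐᵒᵖ)]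
    (M : Type u) [AddCommGroup M] [Module Rᵐᵒᵖ M] : Prop :=
  ∀ (F : Type u) [AddCommGroup F] [Module Rᵐᵒᵖ F], Module.FinitePresentation Rᵐᵒᵖ F →
    Subsingleton (Abelian.Ext (ModuleCat.of Rᵐᵒᵖ F) (ModuleCat.of Rᵐᵒᵖ M) 1)

theorem reg_fin_fun {S : Type u} [Ring S] (hS : ∀ x : S, ∃ y : S, x = x * y * x) (n : ℕ) :
    ∀ x : Fin n → S, ∃ f : (Fin n → S) →ₗ[S] S, f x • x = x := by
  induction n with
  | zero => intro x; exact ⟨0, Subsingleton.elim _ _⟩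
  | succ n ih =>
    intro x
    obtain ⟨y, hy⟩ := hS (x 0)
    let b : Fin n → S := fun i => x i.succ
    obtain ⟨g, hg⟩ := ih (b - (x 0 * y) • b)
    let f : (Fin (n + 1) → S) →ₗ[S] S := (LinearMap.toSpanSingleton S S y) ∘ₗ (LinearMap.proj 0)
    let t : (Fin (n + 1) → S) →ₗ[S] (Fin n → S) := LinearMap.funLeft S S Fin.succ
    let h : (Fin (n + 1) → S) →ₗ[S] S :=
      f + (LinearMap.toSpanSingleton S S (1 - x 0 * y)) ∘ₗ g ∘ₗ
        (t - LinearMap.toSpanSingleton S (Fin n → S) b ∘ₗ f)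
    have hx : h x = x 0 * y + g (b - (x 0 * y) • b) * (1 - x 0 * y) := rfl
    refine ⟨h, ?_⟩
    rw [hx]
    generalize g (b - (x 0 * y) • b) = k at hg
    funext i
    refine Fin.cases ?_ (fun i => ?_) i
    · simp only [Pi.smul_apply, smul_eq_mul, add_mul, mul_assoc, sub_mul, one_mul]
      rw [← mul_assoc (x 0) y (x 0), ← hy]; simp
    · have := congrFun hg i
      simp only [Pi.smul_apply, smul_eq_mul, Pi.sub_apply, b] at this ⊢
      rw [add_mul, mul_assoc k, sub_mul, one_mul, this]; abel

theorem reg_fg_proj {S P : Type*} [Ring S] [AddCommGroup P] [Module S P]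
    (hP : ∀ x : P, ∃ f : P →ₗ[S] S, f x • x = x) (s : Finset P) :
    ∃ p : P →ₗ[S] P, (∀ z, p z ∈ Submodule.span S (s : Set P)) ∧
      ∀ z ∈ Submodule.span S (s : Set P), p z = z := by
  classical
  induction s using Finset.induction_on with
  | empty => exact ⟨0, by simp, by simp +contextual⟩
  | insert x s _ ih =>
    obtain ⟨p, hp1, hp2⟩ := ih
    obtain ⟨f, hf⟩ := hP (x - p x)
    have hle : Submodule.span S (s : Set P) ≤ Submodule.span S ((insert x s : Finset P) : Set P) :=
      Submodule.span_mono (by simp)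
    have hxm : x ∈ Submodule.span S ((insert x s : Finset P) : Set P) :=
      Submodule.subset_span (by simp)
    let q : P →ₗ[S] P := p + LinearMap.toSpanSingleton S P (x - p x) ∘ₗ f ∘ₗ (LinearMap.id - p)
    have hq : ∀ z, q z = p z + f (z - p z) • (x - p x) := fun z => rfl
    refine ⟨q, fun z => ?_, fun z hz => ?_⟩
    · rw [hq]
      exact add_mem (hle (hp1 z)) (Submodule.smul_mem _ _ (sub_mem hxm (hle (hp1 x))))
    · have : Set.EqOn q (LinearMap.id : P →ₗ[S] P) ((insert x s : Finset P) : Set P) := by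
        intro w hw
        rw [Finset.mem_coe, Finset.mem_insert] at hw
        rw [hq]
        rcases hw with rfl | hw
        · rw [hf]; simp
        · rw [hp2 w (Submodule.subset_span hw)]; simp
      exact LinearMap.eqOn_span this hz

theorem reg_fp_projective {S : Type u} [Ring S] (hS : ∀ x : S, ∃ y : S, x = x * y * x)
    (F : Type*) [AddCommGroup F] [Module S F] [Module.FinitePresentation S F] :
    Module.Projective S F := by
  obtain ⟨n, K, e, s, hs⟩ := Module.FinitePresentation.exists_fin S F
  obtain ⟨p, hp1, hp2⟩ := reg_fg_proj (reg_fin_fun hS n) s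
  rw [hs] at hp1 hp2
  have : Module.Projective S ((Fin n → S) ⧸ K) := by
    refine Module.Projective.of_split (K.liftQ (LinearMap.id - p) ?_) K.mkQ ?_
    · intro z hz
      simp [hp2 z hz]
    · apply Submodule.linearMap_qext
      refine LinearMap.ext fun z => ?_
      simp [hp1]
  exact Module.Projective.of_equiv e.symm

theorem reg_of_fp_projective {S : Type u} [Ring S]
    (h : ∀ (F : Type u) [AddCommGroup F] [Module S F], Module.FinitePresentation S F →
      Module.Projective S F) (x : S) : ∃ y : S, x = x * y * x := by
  let K : Submodule S S := Submodule.span S {x}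
  have hfp : Module.FinitePresentation S (S ⧸ K) :=
    Module.finitePresentation_of_surjective K.mkQ K.mkQ_surjective
      (by rw [Submodule.ker_mkQ]; exact Submodule.fg_span_singleton x)
  have := h _ hfp
  obtain ⟨i, hi⟩ := Module.projective_lifting_property K.mkQ LinearMap.id K.mkQ_surjective
  have h1 : K.mkQ (1 - i (K.mkQ 1)) = 0 := by
    rw [map_sub, ← LinearMap.comp_apply, hi]; simp
  rw [← LinearMap.mem_ker, Submodule.ker_mkQ, Submodule.mem_span_singleton] at h1
  obtain ⟨y, hy⟩ := h1
  refine ⟨y, ?_⟩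
  have hx0 : K.mkQ x = 0 := by
    simp [K, Submodule.mem_span_singleton_self]
  have hx : x * i (K.mkQ 1) = 0 := by
    rw [← smul_eq_mul, ← map_smul, ← map_smul, smul_eq_mul, mul_one, hx0, map_zero]
  rw [mul_assoc, ← smul_eq_mul y x, hy, mul_sub, hx]; simp

theorem vonNeumannRegular_iff_all_modules_fpInjective (R : Type u) [Ring R]
    [HasExt.{u} (ModuleCat.{u} Rᵐᵒᵖ)] :
    (∀ x : R, ∃ y : R, x = x * y * x) ↔
      ∀ (M : Type u) [AddCommGroup M] [Module Rᵐᵒᵖ M], FPInjective R M := by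
  constructor
  · intro hR M _ _ F _ _ hF
    have hS : ∀ x : Rᵐᵒᵖ, ∃ y : Rᵐᵒᵖ, x = x * y * x := fun x => by
      obtain ⟨y, hy⟩ := hR x.unop
      exact ⟨.op y, MulOpposite.unop_injective (by simpa [mul_assoc] using hy)⟩
    have := (IsProjective.iff_projective F).1 (reg_fp_projective hS F)
    exact projective_iff_subsingleton_ext_one.1 this (Y := ModuleCat.of Rᵐᵒᵖ M)
  · intro h x
    obtain ⟨y, hy⟩ := reg_of_fp_projective (S := Rᵐᵒᵖ) (fun F _ _ hF =>
      (IsProjective.iff_projective F).2 (projective_iff_subsingleton_ext_one.2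
        fun Y => h Y F hF)) (.op x)
    exact ⟨y.unop, by simpa [mul_assoc] using congrArg MulOpposite.unop hy⟩
end

section
/- Let R be a ring and Q an arbitrary chain complex of right R-modules. Then the following are equivalent: (1) every chain map f : P → Q with P a bounded chain complex of finitely generated projective right R-modules and H_n(f) = 0 for all n is chain homotopic to zero; (2) the homology module H_n(Q) is FP-injective for all n. -/
open CategoryTheory CategoryTheory.Limits HomologicalComplex TensorProduct

universe u

/-- Extension property used in place of `FPInjective`. -/
def ExtProp (R : Type u) [Ring R] (M : ModuleCat.{u} Rᵐᵒᵖ) : Prop :=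
  ∀ (A B : ModuleCat.{u} Rᵐᵒᵖ), Module.Finite Rᵐᵒᵖ A → Module.Projective Rᵐᵒᵖ A →
    Module.Finite Rᵐᵒᵖ B → Module.Projective Rᵐᵒᵖ B → ∀ (φ : A ⟶ B) (g : A ⟶ M),
    (∀ (K : ModuleCat.{u} Rᵐᵒᵖ) (i : K ⟶ A), i ≫ φ = 0 → i ≫ g = 0) → ∃ e : B ⟶ M, φ ≫ e = g

theorem extProp_of_fpInjective (R : Type u) [Ring R] [HasExt.{u} (ModuleCat.{u} Rᵐᵒᵖ)]
    (M : ModuleCat.{u} Rᵐᵒᵖ) (h : FPInjective R M) : ExtProp R M := by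
  intro A B hA _ hB hBp φ g hg
  have hBfp : Module.FinitePresentation Rᵐᵒᵖ B := Module.finitePresentation_of_projective _ _
  let N := LinearMap.range φ.hom
  have hN : N.FG := by
    have := Module.Finite.range φ.hom
    exact Module.Finite.iff_fg.mp this
  have hF : Module.FinitePresentation Rᵐᵒᵖ (B ⧸ N) :=
    Module.finitePresentation_of_surjective N.mkQ N.mkQ_surjective (by rwa [Submodule.ker_mkQ])
  let S : ShortComplex (ModuleCat.{u} Rᵐᵒᵖ) :=
    ShortComplex.mk (ModuleCat.ofHom N.subtype) (ModuleCat.ofHom N.mkQ) (by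
      ext x; simp)
  have hS : S.ShortExact := by
    have h1 : S.Exact := by
      rw [ShortComplex.moduleCat_exact_iff]
      intro x hx
      have : x ∈ N := by simpa [S] using hx
      exact ⟨⟨x, this⟩, rfl⟩
    have h2 : Mono S.f := (ModuleCat.mono_iff_injective _).2 N.injective_subtype
    have h3 : Epi S.g := (ModuleCat.epi_iff_surjective _).2 N.mkQ_surjective
    exact { exact := h1, mono_f := h2, epi_g := h3 }
  have hker : LinearMap.ker φ.hom ≤ LinearMap.ker g.hom := by
    intro x hx
    have := hg (ModuleCat.of _ (LinearMap.ker φ.hom))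
      (ModuleCat.ofHom (LinearMap.ker φ.hom).subtype) (by ext y; simp)
    have := congrArg (fun t => t.hom ⟨x, hx⟩) this
    simpa using this
  let g' : N →ₗ[Rᵐᵒᵖ] M :=
    ((LinearMap.ker φ.hom).liftQ g.hom hker) ∘ₗ φ.hom.quotKerEquivRange.symm.toLinearMap
  have hg' : ∀ x : A, g' (φ.hom.rangeRestrict x) = g.hom x := by
    intro x
    have : φ.hom.quotKerEquivRange.symm (φ.hom.rangeRestrict x) = Submodule.Quotient.mk x := by
      rw [LinearEquiv.symm_apply_eq]; rfl
    change (LinearMap.ker φ.hom).liftQ g.hom hker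
      (φ.hom.quotKerEquivRange.symm (φ.hom.rangeRestrict x)) = _
    rw [this]; rfl
  have hsub := h (B ⧸ N) hF
  obtain ⟨x₂, hx₂⟩ := Abelian.Ext.contravariant_sequence_exact₁ hS M
    (Abelian.Ext.mk₀ (ModuleCat.ofHom g' : S.X₁ ⟶ M)) (add_zero 1) (hsub.elim _ _)
  obtain ⟨e, rfl⟩ := (Abelian.Ext.mk₀_bijective _ _).2 x₂
  rw [Abelian.Ext.mk₀_comp_mk₀] at hx₂
  have he := (Abelian.Ext.mk₀_bijective _ _).1 hx₂
  refine ⟨e, ?_⟩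
  ext x
  rw [← hg' x]
  exact congrArg (fun t => t.hom (φ.hom.rangeRestrict x)) he

theorem fpInjective_of_extProp (R : Type u) [Ring R] [HasExt.{u} (ModuleCat.{u} Rᵐᵒᵖ)]
    (M : ModuleCat.{u} Rᵐᵒᵖ) (h : ExtProp R M) : FPInjective R M := by
  intro F _ _ hF
  obtain ⟨n, m, f, g, hf, hfg⟩ := Module.FinitePresentation.exists_fin' Rᵐᵒᵖ F
  let N := LinearMap.ker f
  let S : ShortComplex (ModuleCat.{u} Rᵐᵒᵖ) :=
    ShortComplex.mk (ModuleCat.ofHom N.subtype) (ModuleCat.ofHom f) (by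
      ext x; simp [N])
  have hS : S.ShortExact := by
    have h1 : S.Exact := by
      rw [ShortComplex.moduleCat_exact_iff]
      intro x hx
      have : x ∈ N := hx
      exact ⟨⟨x, this⟩, rfl⟩
    have h2 : Mono S.f := (ModuleCat.mono_iff_injective _).2 N.injective_subtype
    have h3 : Epi S.g := (ModuleCat.epi_iff_surjective _).2 hf
    exact { exact := h1, mono_f := h2, epi_g := h3 }
  have hP : Projective S.X₂ := 
    (IsProjective.iff_projective (R := Rᵐᵒᵖ) (Fin n → Rᵐᵒᵖ)).1 inferInstance
  refine subsingleton_of_forall_eq 0 fun x => ?_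
  obtain ⟨x₁, hx₁⟩ := Abelian.Ext.contravariant_sequence_exact₃ hS M (n₁ := 1) x
    (Abelian.Ext.eq_zero_of_projective _) (add_zero 1)
  obtain ⟨g₀, rfl⟩ := (Abelian.Ext.mk₀_bijective _ _).2 x₁
  have hgN : ∀ y, g y ∈ N := fun y => (hfg (g y)).2 ⟨y, rfl⟩
  let q : (Fin m → Rᵐᵒᵖ) →ₗ[Rᵐᵒᵖ] N := g.codRestrict N hgN
  obtain ⟨e, he⟩ := h (ModuleCat.of _ (Fin m → Rᵐᵒᵖ)) (ModuleCat.of _ (Fin n → Rᵐᵒᵖ))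
    inferInstance inferInstance inferInstance inferInstance (ModuleCat.ofHom g)
    (ModuleCat.ofHom q ≫ g₀) (by
      intro K i hi
      have : i ≫ ModuleCat.ofHom q = 0 := by
        ext y
        have := congrArg (fun t => t.hom y) hi
        exact congrFun this _
      rw [← Category.assoc]
      erw [this]
      exact zero_comp)
  have he' : S.f ≫ e = g₀ := by
    ext y
    obtain ⟨z, hz⟩ := (hfg y.1).1 y.2
    have hy : q z = y := Subtype.ext hz
    have := congrArg (fun t => t.hom z) he
    have h2 : e.hom (g z) = g₀.hom (q z) := this
    rw [hy, hz] at h2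
    exact h2
  rw [← hx₁, ← he', ← Abelian.Ext.mk₀_comp_mk₀, ShortComplex.ShortExact.extClass_comp_assoc]

theorem gh_step (R : Type u) [Ring R] {P Q : ChainComplex (ModuleCat.{u} Rᵐᵒᵖ) ℤ}
    (hP : ∀ n : ℤ, Module.Finite Rᵐᵒᵖ (P.X n) ∧ Module.Projective Rᵐᵒᵖ (P.X n))
    (f : P ⟶ Q) (n : ℤ) (hf : homologyMap f (n + 1) = 0) (hQ : ExtProp R (Q.homology (n + 1)))
    (x : P.X n ⟶ Q.X (n + 1))
    (hx : P.d (n + 1) n ≫ x ≫ Q.d (n + 1) n = P.d (n + 1) n ≫ f.f n) :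
    ∃ (x' : P.X n ⟶ Q.X (n + 1)) (y : P.X (n + 1) ⟶ Q.X (n + 1 + 1)),
      x' ≫ Q.d (n + 1) n = x ≫ Q.d (n + 1) n ∧
      P.d (n + 1) n ≫ x' + y ≫ Q.d (n + 1 + 1) (n + 1) = f.f (n + 1) := by
  have hpr : ∀ k, Projective (P.X k) := fun k =>
    (IsProjective.iff_projective (R := Rᵐᵒᵖ) (P.X k)).1 (hP k).2
  have hpr1 := hpr n
  have hpr2 := hpr (n + 1)
  have hnext : (ComplexShape.down ℤ).next (n + 1) = n := by simp
  have hprev : (ComplexShape.down ℤ).prev (n + 1) = n + 1 + 1 := by simp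
  let g := Q.liftCycles (f.f (n + 1) - P.d (n + 1) n ≫ x) n hnext (by
    simp [hx])
  obtain ⟨e, he⟩ := hQ (P.X (n + 1)) (P.X n) (hP _).1 (hP _).2 (hP _).1 (hP _).2
    (P.d (n + 1) n) (g ≫ Q.homologyπ (n + 1)) (by
      intro K i hi
      have h1 : i ≫ g = P.liftCycles i n hnext hi ≫ cyclesMap f (n + 1) := by
        rw [← cancel_mono (Q.iCycles (n + 1))]
        have h0 : i ≫ P.d (n + 1) n ≫ x = 0 := by rw [← Category.assoc, hi, zero_comp]
        simp [g, h0]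
      rw [← Category.assoc, h1, Category.assoc, ← homologyπ_naturality, hf, comp_zero, comp_zero])
  let e' : P.X n ⟶ Q.cycles (n + 1) := Projective.factorThru e (Q.homologyπ (n + 1))
  have he' : e' ≫ Q.homologyπ (n + 1) = e := Projective.factorThru_comp _ _
  let T : ShortComplex (ModuleCat.{u} Rᵐᵒᵖ) :=
    ShortComplex.mk (Q.toCycles (n + 1 + 1) (n + 1)) (Q.homologyπ (n + 1)) (by simp)
  have hT : T.Exact := T.exact_of_g_is_cokernel (Q.homologyIsCokernel _ _ hprev)
  have hz : (g - P.d (n + 1) n ≫ e') ≫ T.g = 0 := by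
    change (g - P.d (n + 1) n ≫ e') ≫ Q.homologyπ (n + 1) = 0
    rw [Preadditive.sub_comp, Category.assoc, he', he, sub_self]
  let y : P.X (n + 1) ⟶ Q.X (n + 1 + 1) := hT.liftFromProjective _ hz
  have hy : y ≫ Q.toCycles (n + 1 + 1) (n + 1) = g - P.d (n + 1) n ≫ e' :=
    hT.liftFromProjective_comp _ hz
  refine ⟨x + e' ≫ Q.iCycles (n + 1), y, by simp, ?_⟩
  have := congrArg (fun t => t ≫ Q.iCycles (n + 1)) hy
  simp only [Category.assoc, toCycles_i, Preadditive.sub_comp, g, liftCycles_i] at this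
  rw [this, Preadditive.comp_add]
  abel

theorem gh_backward (R : Type u) [Ring R] {P Q : ChainComplex (ModuleCat.{u} Rᵐᵒᵖ) ℤ}
    (hP : ∀ n : ℤ, Module.Finite Rᵐᵒᵖ (P.X n) ∧ Module.Projective Rᵐᵒᵖ (P.X n))
    (a : ℤ) (ha : ∀ n < a, IsZero (P.X n))
    (f : P ⟶ Q) (hf : ∀ n, homologyMap f n = 0) (hQ : ∀ n, ExtProp R (Q.homology n)) :
    Nonempty (Homotopy f 0) := by
  let C : ℤ → Type u := fun n => { x : P.X n ⟶ Q.X (n + 1) //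
    P.d (n + 1) n ≫ x ≫ Q.d (n + 1) n = P.d (n + 1) n ≫ f.f n }
  have step : ∀ (n : ℤ) (x : C n), ∃ y : C (n + 1), ∃ x' : P.X n ⟶ Q.X (n + 1),
      x' ≫ Q.d (n + 1) n = x.1 ≫ Q.d (n + 1) n ∧
      P.d (n + 1) n ≫ x' + y.1 ≫ Q.d (n + 1 + 1) (n + 1) = f.f (n + 1) := by
    intro n x
    obtain ⟨x', y, h1, h2⟩ := gh_step R hP f n (hf _) (hQ _) x.1 x.2
    refine ⟨⟨y, ?_⟩, x', h1, h2⟩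
    rw [← h2]
    simp
  choose nx hnx using step
  have base : ∀ n < a, P.d (n + 1) n ≫ (0 : P.X n ⟶ Q.X (n + 1)) ≫ Q.d (n + 1) n
      = P.d (n + 1) n ≫ f.f n := by
    intro n hn
    rw [(ha n hn).eq_of_src (f.f n) 0]; simp
  let X : ∀ n, C n := fun n => Int.inductionOn' (motive := C) n (a - 1)
    ⟨0, base _ (by omega)⟩ (fun k _ x => nx k x) (fun k hk _ => ⟨0, base _ (by omega)⟩)
  have hX : ∀ n, ∃ x' : P.X n ⟶ Q.X (n + 1),
      x' ≫ Q.d (n + 1) n = (X n).1 ≫ Q.d (n + 1) n ∧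
      P.d (n + 1) n ≫ x' + (X (n + 1)).1 ≫ Q.d (n + 1 + 1) (n + 1) = f.f (n + 1) := by
    intro n
    by_cases hn : a - 1 ≤ n
    · have : X (n + 1) = nx n (X n) := Int.inductionOn'_add_one hn
      rw [this]
      exact hnx n (X n)
    · exact ⟨(X n).1, rfl, (ha (n + 1) (by omega)).eq_of_src _ _⟩
  choose x' hx1 hx2 using hX
  let h : ∀ i j, (ComplexShape.down ℤ).Rel j i → (P.X i ⟶ Q.X j) :=
    fun i j r => x' i ≫ eqToHom (congrArg Q.X r)
  have hfe : f = Homotopy.nullHomotopicMap' h := by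
    ext1 k
    obtain ⟨n, rfl⟩ : ∃ n, k = n + 1 := ⟨k - 1, by omega⟩
    rw [Homotopy.nullHomotopicMap'_f (k₂ := n + 1 + 1) (k₁ := n + 1) (k₀ := n) rfl rfl]
    simp only [h, eqToHom_refl, Category.comp_id]
    rw [hx1, hx2]
  rw [hfe]
  exact ⟨Homotopy.nullHomotopy' h⟩

theorem gh_forward (R : Type u) [Ring R] (Q : ChainComplex (ModuleCat.{u} Rᵐᵒᵖ) ℤ)
    (H : ∀ P : ChainComplex (ModuleCat.{u} Rᵐᵒᵖ) ℤ, IsPerfect R P →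
        ∀ f : P ⟶ Q, (∀ n : ℤ, homologyMap f n = 0) → Nonempty (Homotopy f 0)) (n : ℤ) :
    ExtProp R (Q.homology (n + 1)) := by
  intro A B hA hAp hB hBp φ g hg
  have hApr : Projective A := (IsProjective.iff_projective (R := Rᵐᵒᵖ) A).1 hAp
  have hr : (ComplexShape.down ℤ).Rel (n + 1) n := rfl
  have hne : n + 1 ≠ n := by omega
  have hnext : (ComplexShape.down ℤ).next (n + 1) = n := by simp
  let g' : A ⟶ Q.cycles (n + 1) := Projective.factorThru g (Q.homologyπ (n + 1))
  have hg' : g' ≫ Q.homologyπ (n + 1) = g := Projective.factorThru_comp _ _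
  let P := double φ hr
  let i0 : P.X (n + 1) ≅ A := doubleXIso₀ φ hr
  let i1 : P.X n ≅ B := doubleXIso₁ φ hr hne
  have hd : P.d (n + 1) n = i0.hom ≫ φ ≫ i1.inv := double_d φ hr hne
  let f : P ⟶ Q := mkHomFromDouble hr hne (g' ≫ Q.iCycles (n + 1)) 0 (by simp) (by simp)
  have hf0 : f.f (n + 1) = i0.hom ≫ g' ≫ Q.iCycles (n + 1) := mkHomFromDouble_f₀ ..
  have hf1 : f.f n = 0 := (mkHomFromDouble_f₁ ..).trans comp_zero
  have hzero : ∀ k, k ≠ n + 1 → k ≠ n → IsZero (P.X k) := isZero_double_X φ hr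
  have hPerf : IsPerfect R P := by
    refine ⟨⟨n, n + 1, fun k hk => hzero k (by omega) (by omega)⟩, fun k => ?_⟩
    by_cases h0 : k = n + 1
    · subst h0
      exact ⟨Module.Finite.equiv i0.toLinearEquiv.symm,
        Module.Projective.of_equiv i0.toLinearEquiv.symm⟩
    by_cases h1 : k = n
    · subst h1
      exact ⟨Module.Finite.equiv i1.toLinearEquiv.symm,
        Module.Projective.of_equiv i1.toLinearEquiv.symm⟩
    have : Subsingleton (P.X k) := ModuleCat.subsingleton_of_isZero (hzero k h0 h1)
    exact ⟨inferInstance, inferInstance⟩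
  obtain ⟨h⟩ := H P hPerf f (by
    intro k
    rw [← cancel_epi (P.homologyπ k), homologyπ_naturality, comp_zero]
    by_cases h0 : k = n + 1
    · subst h0
      have h2 : cyclesMap f (n + 1) = (P.iCycles (n + 1) ≫ i0.hom) ≫ g' := by
        rw [← cancel_mono (Q.iCycles (n + 1))]
        simp [hf0]
      rw [h2, Category.assoc, hg']
      apply hg
      rw [← cancel_mono i1.inv]
      have := P.iCycles_d (n + 1) n
      rw [hd] at this
      simpa using this
    · have h2 : cyclesMap f k = 0 := by
        rw [← cancel_mono (Q.iCycles k), cyclesMap_i, zero_comp]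
        by_cases h1 : k = n
        · subst h1; rw [hf1, comp_zero]
        · rw [(hzero k h0 h1).eq_of_src (f.f k) 0, comp_zero]
      rw [h2, zero_comp])
  have hd1 := h.comm n
  have hd0 := h.comm (n + 1)
  have hr2 : (ComplexShape.down ℤ).Rel (n + 1 + 1) (n + 1) := rfl
  have hr3 : (ComplexShape.down ℤ).Rel n (n - 1) := by simp
  rw [dNext_eq h.hom hr3, prevD_eq h.hom hr, hf1,
    (hzero (n - 1) (by omega) (by omega)).eq_of_src (h.hom (n - 1) n) 0] at hd1
  rw [dNext_eq h.hom hr, prevD_eq h.hom hr2, hf0, hd] at hd0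
  simp only [comp_zero, zero_add, zero_f, add_zero] at hd1 hd0
  let e' : B ⟶ Q.cycles (n + 1) := Q.liftCycles (i1.inv ≫ h.hom n (n + 1)) n hnext (by
    rw [Category.assoc, ← hd1, comp_zero])
  refine ⟨e' ≫ Q.homologyπ (n + 1), ?_⟩
  have key : g' = φ ≫ e' + (i0.inv ≫ h.hom (n + 1) (n + 1 + 1)) ≫
      Q.toCycles (n + 1 + 1) (n + 1) := by
    rw [← cancel_mono (Q.iCycles (n + 1)), ← cancel_epi i0.hom, hd0]
    simp [e']
  rw [← hg', key]
  simp

theorem generating_hypothesis_with_target_iff_homology_fpInjective (R : Type u) [Ring R]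
    [HasExt.{u} (ModuleCat.{u} Rᵐᵒᵖ)] (Q : ChainComplex (ModuleCat.{u} Rᵐᵒᵖ) ℤ) :
    (∀ P : ChainComplex (ModuleCat.{u} Rᵐᵒᵖ) ℤ, IsPerfect R P →
        ∀ f : P ⟶ Q, (∀ n : ℤ, homologyMap f n = 0) → Nonempty (Homotopy f 0)) ↔
      ∀ n : ℤ, FPInjective R (Q.homology n) := by
  constructor
  · intro H n
    obtain ⟨m, rfl⟩ : ∃ m, n = m + 1 := ⟨n - 1, by omega⟩
    exact fpInjective_of_extProp R _ (gh_forward R Q H m)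
  · rintro H P ⟨⟨a, b, hab⟩, hP⟩ f hf
    exact gh_backward R hP a (fun n hn => hab n (Or.inl hn)) f hf
      (fun n => extProp_of_fpInjective R _ (H n))
end

section
/- A ring R is von Neumann regular if and only if R satisfies the generating hypothesis and R is right coherent, i.e. every finitely generated right ideal of R is finitely presented as a right R-module. -/
open CategoryTheory CategoryTheory.Limits HomologicalComplex TensorProduct

universe u

/-- `R` satisfies the generating hypothesis: every chain map between perfect complexes of
right `R`-modules which induces the zero map on all homology modules is chain homotopic
to zero. -/
def SatisfiesGH (R : Type u) [Ring R] : Prop :=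
  ∀ P Q : ChainComplex (ModuleCat.{u} Rᵐᵒᵖ) ℤ, IsPerfect R P → IsPerfect R Q →
    ∀ f : P ⟶ Q, (∀ n : ℤ, homologyMap f n = 0) → Nonempty (Homotopy f 0)

namespace GHAux

/-- Every linear map from `A` to `B` has a quasi-inverse. -/
def Reg (S : Type*) [Ring S] (A B : Type*) [AddCommGroup A] [Module S A] [AddCommGroup B]
    [Module S B] : Prop :=
  ∀ φ : A →ₗ[S] B, ∃ ψ : B →ₗ[S] A, ∀ a, φ (ψ (φ a)) = φ a

section
variable {S : Type*} [Ring S] {A B A' B' : Type*} [AddCommGroup A] [Module S A] [AddCommGroup B]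
    [Module S B] [AddCommGroup A'] [Module S A'] [AddCommGroup B'] [Module S B']

lemma mccoy (φ : A →ₗ[S] B) (ψ χ : B →ₗ[S] A)
    (h : ∀ a, (φ - φ ∘ₗ ψ ∘ₗ φ) (χ ((φ - φ ∘ₗ ψ ∘ₗ φ) a)) = (φ - φ ∘ₗ ψ ∘ₗ φ) a) :
    ∃ ψ : B →ₗ[S] A, ∀ a, φ (ψ (φ a)) = φ a := by
  refine ⟨ψ + (LinearMap.id - ψ ∘ₗ φ) ∘ₗ χ ∘ₗ (LinearMap.id - φ ∘ₗ ψ), fun a => ?_⟩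
  have := h a
  simp only [LinearMap.sub_apply, LinearMap.comp_apply, LinearMap.add_apply, LinearMap.id_apply,
    map_sub, map_add] at this ⊢
  rw [this]
  abel

lemma Reg.retract (h : Reg S A B) (i : A' →ₗ[S] A) (p : A →ₗ[S] A') (hp : ∀ a, p (i a) = a)
    (j : B' →ₗ[S] B) (q : B →ₗ[S] B') (hq : ∀ a, q (j a) = a) : Reg S A' B' := by
  intro φ
  obtain ⟨ψ, hψ⟩ := h (j ∘ₗ φ ∘ₗ p)
  refine ⟨p ∘ₗ ψ ∘ₗ j, fun a => ?_⟩
  have := congrArg q (hψ (i a))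
  simpa [hp, hq] using this

lemma Reg.prod_left (h : Reg S A B) (h' : Reg S A' B) : Reg S (A × A') B := by
  intro φ
  obtain ⟨a', ha⟩ := h (φ ∘ₗ LinearMap.inl S A A')
  simp only [LinearMap.comp_apply] at ha
  let ψ : B →ₗ[S] (A × A') := LinearMap.inl S A A' ∘ₗ a'
  let ρ := φ - φ ∘ₗ ψ ∘ₗ φ
  obtain ⟨c, hc⟩ := h' (ρ ∘ₗ LinearMap.inr S A A')
  simp only [LinearMap.comp_apply] at hc
  have h1 : ∀ x, ρ x = ρ (LinearMap.inr S A A' x.2) := by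
    intro x
    have : x = LinearMap.inl S A A' x.1 + LinearMap.inr S A A' x.2 := by simp
    conv_lhs => rw [this, map_add]
    rw [add_eq_right]
    simp only [ρ, ψ, LinearMap.sub_apply, LinearMap.comp_apply]
    rw [ha, sub_self]
  refine mccoy φ ψ (LinearMap.inr S A A' ∘ₗ c) fun a => ?_
  change ρ (LinearMap.inr S A A' (c (ρ a))) = ρ a
  rw [h1 a]
  exact hc _

lemma Reg.prod_right (h : Reg S A B) (h' : Reg S A B') : Reg S A (B × B') := by
  intro φ
  obtain ⟨a', ha⟩ := h (LinearMap.fst S B B' ∘ₗ φ)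
  simp only [LinearMap.comp_apply] at ha
  let ψ : (B × B') →ₗ[S] A := a' ∘ₗ LinearMap.fst S B B'
  let ρ := φ - φ ∘ₗ ψ ∘ₗ φ
  obtain ⟨c, hc⟩ := h' (LinearMap.snd S B B' ∘ₗ ρ)
  simp only [LinearMap.comp_apply] at hc
  have h1 : ∀ x, (ρ x).1 = 0 := by
    intro x
    have := ha x
    simp only [LinearMap.fst_apply] at this
    simp only [ρ, ψ, LinearMap.sub_apply, LinearMap.comp_apply, Prod.fst_sub, LinearMap.fst_apply]
    rw [this, sub_self]
  refine mccoy φ ψ (c ∘ₗ LinearMap.snd S B B') fun a => ?_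
  change ρ (c (ρ a).2) = ρ a
  exact Prod.ext ((h1 _).trans (h1 _).symm) (hc a)

lemma Reg.pi_left (h : Reg S S B) (n : ℕ) : Reg S (Fin n → S) B := by
  induction n with
  | zero => intro φ; exact ⟨0, fun a => by rw [Subsingleton.elim a 0]; simp⟩
  | succ n ih =>
    let e := Fin.consLinearEquiv S (fun _ : Fin (n + 1) => S)
    exact (h.prod_left ih).retract e.symm.toLinearMap e.toLinearMap (by simp)
      LinearMap.id LinearMap.id (by simp)

lemma Reg.pi_right (h : Reg S A S) (n : ℕ) : Reg S A (Fin n → S) := by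
  induction n with
  | zero => intro φ; exact ⟨0, fun a => Subsingleton.elim _ _⟩
  | succ n ih =>
    let e := Fin.consLinearEquiv S (fun _ : Fin (n + 1) => S)
    exact (h.prod_right ih).retract LinearMap.id LinearMap.id (by simp)
      e.symm.toLinearMap e.toLinearMap (by simp)

lemma reg_of_vnr (h : ∀ x : S, ∃ y : S, x = x * y * x) : Reg S S S := by
  intro φ
  have hφ : ∀ a, φ a = a * φ 1 := fun a => by
    rw [← smul_eq_mul, ← map_smul, smul_eq_mul, mul_one]
  obtain ⟨y, hy⟩ := h (φ 1)
  refine ⟨LinearMap.toSpanSingleton S S y, fun a => ?_⟩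
  simp only [LinearMap.toSpanSingleton_apply, smul_eq_mul]
  rw [hφ, hφ a, mul_assoc, mul_assoc, ← mul_assoc (φ 1), ← hy]

lemma exists_retract (A : Type*) [AddCommGroup A] [Module S A] [Module.Finite S A]
    [Module.Projective S A] : ∃ (n : ℕ) (i : A →ₗ[S] (Fin n → S)) (p : (Fin n → S) →ₗ[S] A),
      ∀ a, p (i a) = a := by
  obtain ⟨n, p, hp⟩ := Module.Finite.exists_fin' S A
  obtain ⟨i, hi⟩ := Module.projective_lifting_property p LinearMap.id hp
  exact ⟨n, i, p, fun a => LinearMap.congr_fun hi a⟩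

lemma reg_of_fgp (h : ∀ x : S, ∃ y : S, x = x * y * x)
    [Module.Finite S A] [Module.Projective S A] [Module.Finite S B] [Module.Projective S B] :
    Reg S A B := by
  obtain ⟨n, i, p, hp⟩ := exists_retract (S := S) A
  obtain ⟨m, j, q, hq⟩ := exists_retract (S := S) B
  exact (((reg_of_vnr h).pi_left n).pi_right m).retract i p hp j q hq

end

/-- `R` as a right module over itself is free of rank one. -/
def opEquiv (R : Type u) [Ring R] : R ≃ₗ[Rᵐᵒᵖ] Rᵐᵒᵖ where
  toFun := MulOpposite.op
  invFun := MulOpposite.unop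
  map_add' _ _ := rfl
  map_smul' _ _ := rfl
  left_inv _ := rfl
  right_inv _ := rfl

lemma fin_R (R : Type u) [Ring R] : Module.Finite Rᵐᵒᵖ R := Module.Finite.equiv (opEquiv R).symm
lemma proj_R (R : Type u) [Ring R] : Module.Projective Rᵐᵒᵖ R :=
  Module.Projective.of_equiv (opEquiv R).symm

lemma vnr_op {R : Type u} [Ring R] (h : ∀ x : R, ∃ y : R, x = x * y * x) :
    ∀ x : Rᵐᵒᵖ, ∃ y : Rᵐᵒᵖ, x = x * y * x := fun x => by
  obtain ⟨y, hy⟩ := h x.unop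
  refine ⟨MulOpposite.op y, MulOpposite.unop_injective ?_⟩
  simpa [mul_assoc] using hy

lemma coherent_of_vnr {R : Type u} [Ring R] (h : ∀ x : R, ∃ y : R, x = x * y * x)
    (I : Submodule Rᵐᵒᵖ R) (hI : I.FG) : Module.FinitePresentation Rᵐᵒᵖ ↥I := by
  have := fin_R R
  have := proj_R R
  have : Module.Finite Rᵐᵒᵖ I := Module.Finite.iff_fg.mpr hI
  obtain ⟨n, p, hp⟩ := Module.Finite.exists_fin' Rᵐᵒᵖ I
  obtain ⟨ψ, hψ⟩ := reg_of_fgp (vnr_op h) (I.subtype ∘ₗ p)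
  have : Module.Projective Rᵐᵒᵖ I := by
    refine Module.Projective.of_split I.subtype (p ∘ₗ ψ) ?_
    ext a
    obtain ⟨b, rfl⟩ := hp a
    exact hψ b
  exact Module.finitePresentation_of_projective Rᵐᵒᵖ I

lemma exists_lift {R : Type u} [Ring R] {P Q : ChainComplex (ModuleCat.{u} Rᵐᵒᵖ) ℤ}
    (f : P ⟶ Q) (i j k : ℤ) (hij : j + 1 = i) (hjk : k + 1 = j) (hf : homologyMap f j = 0)
    [Projective (P.X j)] (p : P.X j ⟶ P.X j) (hp : p ≫ P.d j k = 0) :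
    ∃ h : P.X j ⟶ Q.X i, h ≫ Q.d i j = p ≫ f.f j := by
  have hk : (ComplexShape.down ℤ).next j = k := ComplexShape.next_eq' _ (by simpa using hjk)
  have hi : (ComplexShape.down ℤ).prev j = i := ComplexShape.prev_eq' _ (by simpa using hij)
  let l := P.liftCycles p k hk hp
  have h0 : (l ≫ cyclesMap f j) ≫ Q.homologyπ j = 0 := by
    rw [Category.assoc, ← homologyπ_naturality, hf, comp_zero, comp_zero]
  let T : ShortComplex (ModuleCat.{u} Rᵐᵒᵖ) :=
    ShortComplex.mk (Q.toCycles i j) (Q.homologyπ j) (by simp)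
  have hT : T.Exact := ShortComplex.exact_of_g_is_cokernel _ (Q.homologyIsCokernel i j hi)
  refine ⟨hT.liftFromProjective (l ≫ cyclesMap f j) h0, ?_⟩
  have := hT.liftFromProjective_comp (l ≫ cyclesMap f j) h0
  have h2 := congrArg (· ≫ Q.iCycles j) this
  simpa [T, l] using h2

lemma gh_of_vnr {R : Type u} [Ring R] (hR : ∀ x : R, ∃ y : R, x = x * y * x) :
    SatisfiesGH R := by
  intro P Q hP hQ f hf
  have hs : ∀ i j : ℤ, ∃ s : P.X i ⟶ P.X j, P.d j i ≫ s ≫ P.d j i = P.d j i := by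
    intro i j
    have := (hP.2 i).1
    have := (hP.2 i).2
    have := (hP.2 j).1
    have := (hP.2 j).2
    obtain ⟨ψ, hψ⟩ := reg_of_fgp (vnr_op hR) (P.d j i).hom
    refine ⟨ModuleCat.ofHom ψ, ?_⟩
    ext a
    exact hψ a
  choose s hs using hs
  have hp : ∀ i, (𝟙 (P.X i) - P.d i (i-1) ≫ s (i-1) i) ≫ P.d i (i-1) = 0 := by
    intro i
    rw [Preadditive.sub_comp, Category.assoc, hs, Category.id_comp, sub_self]
  have hh : ∀ i j : ℤ, ∃ h : P.X i ⟶ Q.X j, i + 1 = j →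
      h ≫ Q.d j i = (𝟙 (P.X i) - P.d i (i-1) ≫ s (i-1) i) ≫ f.f i := by
    intro i j
    by_cases hij : i + 1 = j
    · have := (hP.2 i).2
      have : Projective (P.X i) := by
        rw [← IsProjective.iff_projective]; infer_instance
      obtain ⟨h, hh⟩ := exists_lift f j i (i-1) hij (by ring) (hf i) _ (hp i)
      exact ⟨h, fun _ => hh⟩
    · exact ⟨0, fun h => (hij h).elim⟩
  choose h hh using hh
  refine ⟨{ hom := fun i j => if i + 1 = j then
              h i j + s i j ≫ P.d j i ≫ (s i j ≫ f.f j - h i j) else 0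
            zero := fun i j hij => if_neg (by simpa using hij)
            comm := fun i => ?_ }⟩
  rw [dNext_eq _ (show (ComplexShape.down ℤ).Rel i (i-1) by simp),
    prevD_eq _ (show (ComplexShape.down ℤ).Rel (i+1) i by simp)]
  rw [if_pos (by ring), if_pos rfl]
  have e1 : P.d i (i-1) ≫ (h (i-1) i + s (i-1) i ≫ P.d i (i-1) ≫ (s (i-1) i ≫ f.f i - h (i-1) i))
      = P.d i (i-1) ≫ s (i-1) i ≫ f.f i := by
    have := hs (i-1) i
    rw [Preadditive.comp_add]
    rw [← Category.assoc (s _ _), ← Category.assoc (P.d _ _), this]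
    simp
  have e2 : (h i (i+1) + s i (i+1) ≫ P.d (i+1) i ≫ (s i (i+1) ≫ f.f (i+1) - h i (i+1))) ≫
      Q.d (i+1) i = (𝟙 (P.X i) - P.d i (i-1) ≫ s (i-1) i) ≫ f.f i := by
    have h1 := hh i (i+1) rfl
    have h2 := hs i (i+1)
    have h3 := f.comm (i+1) i
    have : P.d (i+1) i ≫ (s i (i+1) ≫ f.f (i+1) - h i (i+1)) ≫ Q.d (i+1) i = 0 := by
      rw [Preadditive.sub_comp, h1, Category.assoc, h3, Preadditive.sub_comp, Preadditive.comp_sub,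
        Preadditive.comp_sub]
      rw [← Category.assoc (s _ _), ← Category.assoc (P.d _ _), h2]
      simp
    rw [Preadditive.add_comp, h1, Category.assoc, Category.assoc, this]
    simp
  rw [e1, e2]
  simp

section three
variable {S : Type u} [Ring S]

/-- Terms of a three term complex. -/
def tX (A B C : ModuleCat.{u} S) : ℤ → ModuleCat.{u} S
  | .ofNat 0 => A
  | .ofNat 1 => B
  | .ofNat 2 => C
  | _ => ModuleCat.of S PUnit

/-- Differentials of a three term complex. -/
def tD {A B C : ModuleCat.{u} S} (d₁ : B ⟶ A) (d₂ : C ⟶ B) :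
    (i j : ℤ) → (tX A B C i ⟶ tX A B C j)
  | .ofNat 1, .ofNat 0 => d₁
  | .ofNat 2, .ofNat 1 => d₂
  | _, _ => 0

lemma tD_zero {A B C : ModuleCat.{u} S} (d₁ : B ⟶ A) (d₂ : C ⟶ B) (i j : ℤ)
    (h1 : i = 1 → j = 0 → False) (h2 : i = 2 → j = 1 → False) : tD d₁ d₂ i j = 0 := by
  rcases i with (_ | _ | _ | i) | i <;> rcases j with (_ | _ | _ | j) | j <;>
    first
    | exact (h1 rfl rfl).elim
    | exact (h2 rfl rfl).elim
    | rfl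

/-- The three term complex. -/
def three {A B C : ModuleCat.{u} S} (d₁ : B ⟶ A) (d₂ : C ⟶ B) (w : d₂ ≫ d₁ = 0) :
    ChainComplex (ModuleCat.{u} S) ℤ where
  X := tX A B C
  d := tD d₁ d₂
  shape i j hij := by
    refine tD_zero d₁ d₂ i j ?_ ?_
    · rintro rfl rfl
      exact hij (by decide)
    · rintro rfl rfl
      exact hij (by decide)
  d_comp_d' i j k hij hjk := by
    simp only [ComplexShape.down_Rel] at hij hjk
    subst hij
    subst hjk
    by_cases hk : k = 0
    · subst hk
      exact w
    · have : tD d₁ d₂ (k + 1) k = 0 ∨ tD d₁ d₂ (k + 1 + 1) (k+1) = 0 := by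
        by_cases h1 : k = 1
        · subst h1; right; rfl
        left
        exact tD_zero d₁ d₂ _ _ (fun _ h => hk h) (fun _ h => h1 h)
      rcases this with h | h <;> rw [h] <;> simp

lemma three_isPerfect {R : Type u} [Ring R] {A B C : ModuleCat.{u} Rᵐᵒᵖ} (d₁ : B ⟶ A) (d₂ : C ⟶ B)
    (w : d₂ ≫ d₁ = 0) [Module.Finite Rᵐᵒᵖ A] [Module.Projective Rᵐᵒᵖ A]
    [Module.Finite Rᵐᵒᵖ B] [Module.Projective Rᵐᵒᵖ B]
    [Module.Finite Rᵐᵒᵖ C] [Module.Projective Rᵐᵒᵖ C] : IsPerfect R (three d₁ d₂ w) := by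
  constructor
  · refine ⟨0, 2, fun n hn => ?_⟩
    have hz := ModuleCat.isZero_of_subsingleton (ModuleCat.of Rᵐᵒᵖ PUnit.{u+1})
    rcases n with (_ | _ | _ | n) | n
    · simp at hn
    · simp at hn
    · simp at hn
    · exact hz
    · exact hz
  · intro n
    have h1 : Module.Finite Rᵐᵒᵖ (ModuleCat.of Rᵐᵒᵖ PUnit.{u+1}) :=
      inferInstanceAs (Module.Finite Rᵐᵒᵖ PUnit.{u+1})
    have h2 : Module.Projective Rᵐᵒᵖ (ModuleCat.of Rᵐᵒᵖ PUnit.{u+1}) :=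
      inferInstanceAs (Module.Projective Rᵐᵒᵖ PUnit.{u+1})
    rcases n with (_ | _ | _ | n) | n
    · exact ⟨‹Module.Finite Rᵐᵒᵖ A›, ‹Module.Projective Rᵐᵒᵖ A›⟩
    · exact ⟨‹Module.Finite Rᵐᵒᵖ B›, ‹Module.Projective Rᵐᵒᵖ B›⟩
    · exact ⟨‹Module.Finite Rᵐᵒᵖ C›, ‹Module.Projective Rᵐᵒᵖ C›⟩
    · exact ⟨h1, h2⟩
    · exact ⟨h1, h2⟩

/-- Components of a map concentrated in degree one. -/
def tF {A B C A' B' C' : ModuleCat.{u} S} (g : B ⟶ B') : (i : ℤ) → (tX A B C i ⟶ tX A' B' C' i)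
  | .ofNat 1 => g
  | _ => 0

lemma tF_zero {A B C A' B' C' : ModuleCat.{u} S} (g : B ⟶ B') (i : ℤ) (hi : i ≠ 1) :
    tF (A := A) (C := C) (A' := A') (C' := C') g i = 0 := by
  rcases i with (_ | _ | i) | i
  · rfl
  · exact (hi rfl).elim
  · rfl
  · rfl

/-- A map of three term complexes concentrated in degree one. -/
def threeMap {A B C A' B' C' : ModuleCat.{u} S} (d₁ : B ⟶ A) (d₂ : C ⟶ B) (w : d₂ ≫ d₁ = 0)
    (d₁' : B' ⟶ A') (d₂' : C' ⟶ B') (w' : d₂' ≫ d₁' = 0) (g : B ⟶ B') (h₁ : g ≫ d₁' = 0)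
    (h₂ : d₂ ≫ g = 0) : three d₁ d₂ w ⟶ three d₁' d₂' w' where
  f := tF g
  comm' i j hij := by
    simp only [ComplexShape.down_Rel] at hij
    subst hij
    change tF g (j+1) ≫ tD d₁' d₂' (j+1) j = tD d₁ d₂ (j+1) j ≫ tF g j
    by_cases h0 : j = 0
    · subst h0
      change g ≫ d₁' = d₁ ≫ 0
      rw [h₁, comp_zero]
    by_cases h1 : j = 1
    · subst h1
      change 0 ≫ d₂' = d₂ ≫ g
      rw [h₂, zero_comp]
    rw [tF_zero g j h1, tF_zero g (j+1) (by omega), zero_comp, comp_zero]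

end three

lemma homologyMap_zero_of {S : Type u} [Ring S] {P Q : ChainComplex (ModuleCat.{u} S) ℤ}
    (f : P ⟶ Q) (n : ℤ) (h : f.f n = 0) : homologyMap f n = 0 := by
  rw [← cancel_epi (P.homologyπ n), homologyπ_naturality]
  have : cyclesMap f n = 0 := by
    rw [← cancel_mono (Q.iCycles n), cyclesMap_i, h]
    simp
  rw [this]
  simp

lemma gh_ext {R : Type u} [Ring R] (hR : SatisfiesGH R) {A₀ A₁ A₂ B₀ B₁ : Type u}
    [AddCommGroup A₀] [AddCommGroup A₁] [AddCommGroup A₂] [AddCommGroup B₀] [AddCommGroup B₁]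
    [Module Rᵐᵒᵖ A₀] [Module Rᵐᵒᵖ A₁] [Module Rᵐᵒᵖ A₂] [Module Rᵐᵒᵖ B₀] [Module Rᵐᵒᵖ B₁]
    [Module.Finite Rᵐᵒᵖ A₀] [Module.Finite Rᵐᵒᵖ A₁] [Module.Finite Rᵐᵒᵖ A₂]
    [Module.Finite Rᵐᵒᵖ B₀] [Module.Finite Rᵐᵒᵖ B₁]
    [Module.Projective Rᵐᵒᵖ A₀] [Module.Projective Rᵐᵒᵖ A₁] [Module.Projective Rᵐᵒᵖ A₂]
    [Module.Projective Rᵐᵒᵖ B₀] [Module.Projective Rᵐᵒᵖ B₁]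
    (d₁ : A₁ →ₗ[Rᵐᵒᵖ] A₀) (d₂ : A₂ →ₗ[Rᵐᵒᵖ] A₁) (hd : Function.Exact d₂ d₁)
    (e : B₁ →ₗ[Rᵐᵒᵖ] B₀) (g : A₁ →ₗ[Rᵐᵒᵖ] B₁) (h₁ : ∀ a, e (g a) = 0) (h₂ : ∀ a, g (d₂ a) = 0) :
    ∃ h : A₀ →ₗ[Rᵐᵒᵖ] B₁, (∀ a, g a = h (d₁ a)) ∧ ∀ a, e (h a) = 0 := by
  have w : ModuleCat.ofHom d₂ ≫ ModuleCat.ofHom d₁ = 0 := by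
    ext a; exact hd.apply_apply_eq_zero a
  let e₂ : ModuleCat.of Rᵐᵒᵖ PUnit.{u+1} ⟶ ModuleCat.of Rᵐᵒᵖ B₁ := 0
  let f := threeMap (ModuleCat.ofHom d₁) (ModuleCat.ofHom d₂) w (ModuleCat.ofHom e) e₂
    (zero_comp) (ModuleCat.ofHom g) (by ext a; exact h₁ a) (by ext a; exact h₂ a)
  have : Module.Finite Rᵐᵒᵖ (ModuleCat.of Rᵐᵒᵖ PUnit.{u+1}) :=
    inferInstanceAs (Module.Finite Rᵐᵒᵖ PUnit.{u+1})
  have : Module.Projective Rᵐᵒᵖ (ModuleCat.of Rᵐᵒᵖ PUnit.{u+1}) :=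
    inferInstanceAs (Module.Projective Rᵐᵒᵖ PUnit.{u+1})
  have hf : ∀ n, homologyMap f n = 0 := by
    intro n
    by_cases hn : n = 1
    · subst hn
      have : (three (ModuleCat.ofHom d₁) (ModuleCat.ofHom d₂) w).ExactAt 1 := by
        rw [exactAt_iff' _ 2 1 0 (ComplexShape.prev_eq' _ (by decide))
          (ComplexShape.next_eq' _ (by decide)), ShortComplex.moduleCat_exact_iff]
        intro x hx
        exact (hd x).1 hx
      exact (this.isZero_homology).eq_of_src _ _
    · exact homologyMap_zero_of f n (tF_zero _ n hn)
  obtain ⟨H⟩ := hR _ _ (three_isPerfect _ _ _) (three_isPerfect _ _ _) f hf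
  have c0 := H.comm 0
  have c1 := H.comm 1
  rw [dNext_eq _ (show (ComplexShape.down ℤ).Rel 0 (-1) by decide),
    prevD_eq _ (show (ComplexShape.down ℤ).Rel 1 0 by decide)] at c0
  rw [dNext_eq _ (show (ComplexShape.down ℤ).Rel 1 0 by decide),
    prevD_eq _ (show (ComplexShape.down ℤ).Rel 2 1 by decide)] at c1
  let h : ModuleCat.of Rᵐᵒᵖ A₀ ⟶ ModuleCat.of Rᵐᵒᵖ B₁ := H.hom 0 1
  have c0' : (0 : ModuleCat.of Rᵐᵒᵖ A₀ ⟶ ModuleCat.of Rᵐᵒᵖ B₀) = h ≫ ModuleCat.ofHom e := by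
    refine c0.trans ?_
    have : (three (ModuleCat.ofHom d₁) (ModuleCat.ofHom d₂) w).d 0 (-1) = 0 := rfl
    rw [this, zero_comp, zero_add]
    exact add_zero _
  have c1' : ModuleCat.ofHom g = ModuleCat.ofHom d₁ ≫ h := by
    refine c1.trans ?_
    have : (three (ModuleCat.ofHom e) e₂ zero_comp).d 2 1 = 0 := rfl
    rw [this, comp_zero, add_zero]
    exact add_zero _
  exact ⟨h.hom, fun a => congrArg (fun k => k.hom a) c1',
    fun a => (congrArg (fun k => k.hom a) c0').symm⟩

/-- Left multiplication as a map of right modules. -/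
def lm {R : Type u} [Ring R] (x : R) : R →ₗ[Rᵐᵒᵖ] R where
  toFun r := x * r
  map_add' := mul_add x
  map_smul' m r := by
    change x * (r * m.unop) = x * r * m.unop
    rw [mul_assoc]

lemma vnr_of_gh {R : Type u} [Ring R] (hR : SatisfiesGH R)
    (hc : ∀ I : Submodule Rᵐᵒᵖ R, I.FG → Module.FinitePresentation Rᵐᵒᵖ ↥I) (x : R) :
    ∃ y : R, x = x * y * x := by
  have := fin_R R
  have := proj_R R
  have happ : ∀ (h : R →ₗ[Rᵐᵒᵖ] R) (r : R), h r = h 1 * r := fun h r => by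
    have := h.map_smul (MulOpposite.op r) 1
    simpa using this
  have : Module.FinitePresentation Rᵐᵒᵖ (LinearMap.range (lm x)) :=
    hc _ (Module.Finite.iff_fg.mp inferInstance)
  have hK : (LinearMap.ker (lm x)).FG := by
    have := Module.FinitePresentation.fg_ker (lm x).rangeRestrict (lm x).surjective_rangeRestrict
    rwa [LinearMap.ker_rangeRestrict] at this
  have := hc _ hK
  obtain ⟨a, p, hp⟩ := Module.Finite.exists_fin' Rᵐᵒᵖ (LinearMap.ker (lm x))
  have hL := Module.FinitePresentation.fg_ker p hp
  have : Module.Finite Rᵐᵒᵖ (LinearMap.ker p) := Module.Finite.iff_fg.mpr hL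
  obtain ⟨b, q, hq⟩ := Module.Finite.exists_fin' Rᵐᵒᵖ (LinearMap.ker p)
  have hex : Function.Exact ((LinearMap.ker p).subtype ∘ₗ q)
      ((LinearMap.ker (lm x)).subtype ∘ₗ p) := by
    intro v
    constructor
    · intro hv
      have hv' : p v = 0 := Subtype.ext hv
      obtain ⟨w, hw⟩ := hq ⟨v, hv'⟩
      exact ⟨w, congrArg Subtype.val hw⟩
    · rintro ⟨w, rfl⟩
      exact congrArg Subtype.val (q w).2
  obtain ⟨h, hh1, hh2⟩ := gh_ext hR _ _ hex (lm x) ((LinearMap.ker (lm x)).subtype ∘ₗ p)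
    (fun v => (p v).2) (fun v => hex.apply_apply_eq_zero v)
  have he : ∀ k, x * k = 0 → h 1 * k = k := by
    intro k hk
    obtain ⟨v, hv⟩ := hp ⟨k, hk⟩
    have := hh1 v
    simp only [LinearMap.comp_apply, hv, Submodule.subtype_apply] at this
    rw [← happ]
    exact this.symm
  have hxe : x * h 1 = 0 := hh2 1
  have hex2 : Function.Exact (lm (h 1)) (lm x) := by
    intro v
    constructor
    · intro hv
      exact ⟨v, he v hv⟩
    · rintro ⟨w, rfl⟩
      change x * (h 1 * w) = 0
      rw [← mul_assoc, hxe, zero_mul]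
  obtain ⟨k, hk, -⟩ := gh_ext hR _ _ hex2 (0 : R →ₗ[Rᵐᵒᵖ] R) (lm (1 - h 1)) (fun _ => rfl)
    (fun v => by
      change (1 - h 1) * (h 1 * v) = 0
      rw [← mul_assoc, sub_mul, one_mul, he _ hxe, sub_self, zero_mul])
  refine ⟨k 1, ?_⟩
  have h1 : (1 - h 1) * 1 = k (x * 1) := hk 1
  rw [mul_one, mul_one, happ k] at h1
  rw [mul_assoc, ← h1, mul_sub, hxe, mul_one, sub_zero]

end GHAux

theorem vonNeumannRegular_iff_gh_and_rightCoherent (R : Type u) [Ring R] :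
    (∀ x : R, ∃ y : R, x = x * y * x) ↔
      (SatisfiesGH R ∧
        ∀ I : Submodule Rᵐᵒᵖ R, I.FG → Module.FinitePresentation Rᵐᵒᵖ ↥I) :=
  ⟨fun h => ⟨GHAux.gh_of_vnr h, fun I hI => GHAux.coherent_of_vnr h I hI⟩,
    fun h x => GHAux.vnr_of_gh h.1 h.2 x⟩
end

section
/- There exists a ring S that satisfies the generating hypothesis but is not von Neumann regular. -/
open CategoryTheory CategoryTheory.Limits HomologicalComplex TensorProduct

universe u

/-- The two ring-level conditions. -/
def CondF (M : Type*) [Ring M] : Prop :=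
  ∀ z c : M, z * c = 0 → ∃ b, z * b = 0 ∧ b * c = c

def CondE (M : Type*) [Ring M] : Prop :=
  ∀ x y z : M, (∀ a, x * a = 0 → ∃ w, y * a = z * w) → ∃ h s, y = z * h + s * x

theorem CondF.of_equiv {M N : Type*} [Ring M] [Ring N] (e : M ≃+* N) (h : CondF M) : CondF N := by
  intro z c hzc
  obtain ⟨b, h1, h2⟩ := h (e.symm z) (e.symm c) (by rw [← map_mul, hzc, map_zero])
  refine ⟨e b, ?_, ?_⟩
  · simpa using congrArg e h1
  · simpa using congrArg e h2

theorem CondE.of_equiv {M N : Type*} [Ring M] [Ring N] (e : M ≃+* N) (h : CondE M) : CondE N := by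
  intro x y z hxyz
  obtain ⟨p, s, h1⟩ := h (e.symm x) (e.symm y) (e.symm z) (by
    intro a ha
    obtain ⟨w, hw⟩ := hxyz (e a) (by simpa using congrArg e ha)
    exact ⟨e.symm w, by simpa using congrArg e.symm hw⟩)
  exact ⟨e p, e s, by simpa using congrArg e h1⟩

theorem seq_cond {S T R : Type*} [Ring S] [Ring T] [Ring R] (φ : T →+* R)
    (hφ : Function.Injective φ) (p : ℕ → S →+* R)
    (h1 : ∀ s s', (∀ n, p n s = p n s') → s = s')
    (h2 : ∀ s, ∃ t, ∀ᶠ n in Filter.atTop, p n s = φ t)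
    (h3 : ∀ (r : ℕ → R) t, (∀ᶠ n in Filter.atTop, r n = φ t) → ∃ s, ∀ n, p n s = r n)
    (hR : ∀ x : R, ∃ g, x * g * x = x)
    (hT : CondF T)
    (hp : ∀ x y z : T, (∃ h s, φ y = φ z * h + s * φ x) → ∃ h s, y = z * h + s * x) :
    CondF S ∧ CondE S := by
  classical
  constructor
  · intro z c hzc
    obtain ⟨tz, htz⟩ := h2 z
    obtain ⟨tc, htc⟩ := h2 c
    have h0 : tz * tc = 0 := by
      obtain ⟨n, hn1, hn2⟩ := (htz.and htc).exists
      apply hφ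
      rw [map_mul, ← hn1, ← hn2, ← map_mul, hzc, map_zero, map_zero]
    obtain ⟨bt, hb1, hb2⟩ := hT tz tc h0
    have hb : ∀ n, ∃ b, p n z * b = 0 ∧ b * p n c = p n c := by
      intro n
      obtain ⟨g, hg⟩ := hR (p n z)
      refine ⟨1 - g * p n z, ?_, ?_⟩
      · rw [mul_sub, mul_one, ← mul_assoc, hg, sub_self]
      · rw [sub_mul, one_mul, mul_assoc, ← map_mul, hzc, map_zero, mul_zero, sub_zero]
    choose b hbz hbc using hb
    obtain ⟨s, hs⟩ := h3 (fun n => if p n z = φ tz ∧ p n c = φ tc then φ bt else b n) bt (by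
      filter_upwards [htz, htc] with n hn1 hn2
      rw [if_pos ⟨hn1, hn2⟩])
    refine ⟨s, h1 _ _ fun n => ?_, h1 _ _ fun n => ?_⟩
    · rw [map_mul, hs]
      split_ifs with h
      · rw [h.1, ← map_mul, hb1, map_zero, map_zero]
      · rw [hbz, map_zero]
    · rw [map_mul, hs]
      split_ifs with h
      · rw [h.2, ← map_mul, hb2]
      · rw [hbc]
  · intro x y z H
    have hn : ∀ n, ∃ h s, p n y = p n z * h + s * p n x := by
      intro n
      obtain ⟨g, hg⟩ := hR (p n x)
      obtain ⟨a, ha⟩ := h3 (fun m => if m = n then 1 - g * p n x else 0) 0 (by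
        filter_upwards [Filter.eventually_gt_atTop n] with m hm
        rw [if_neg hm.ne', map_zero])
      obtain ⟨w, hw⟩ := H a (h1 _ _ fun m => by
        rw [map_mul, ha, map_zero]
        split_ifs with h
        · subst h
          rw [mul_sub, mul_one, ← mul_assoc, hg, sub_self]
        · rw [mul_zero])
      have hw' := congrArg (p n) hw
      rw [map_mul, map_mul, ha, if_pos rfl, mul_sub, mul_one, ← mul_assoc] at hw'
      exact ⟨p n w, p n y * g, by rw [← hw']; abel⟩
    obtain ⟨tx, htx⟩ := h2 x
    obtain ⟨ty, hty⟩ := h2 y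
    obtain ⟨tz, htz⟩ := h2 z
    obtain ⟨ht, st, hst⟩ := hp tx ty tz (by
      obtain ⟨n, hn1, hn2, hn3⟩ := (htx.and (hty.and htz)).exists
      rw [← hn1, ← hn2, ← hn3]
      exact hn n)
    choose h s hhs using hn
    obtain ⟨h', hh'⟩ := h3 (fun n => if p n x = φ tx ∧ p n y = φ ty ∧ p n z = φ tz
        then φ ht else h n) ht (by
      filter_upwards [htx, hty, htz] with n hn1 hn2 hn3
      rw [if_pos ⟨hn1, hn2, hn3⟩])
    obtain ⟨s', hs'⟩ := h3 (fun n => if p n x = φ tx ∧ p n y = φ ty ∧ p n z = φ tz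
        then φ st else s n) st (by
      filter_upwards [htx, hty, htz] with n hn1 hn2 hn3
      rw [if_pos ⟨hn1, hn2, hn3⟩])
    refine ⟨h', s', h1 _ _ fun n => ?_⟩
    rw [map_add, map_mul, map_mul, hh', hs']
    split_ifs with hc
    · rw [hc.1, hc.2.1, hc.2.2, ← map_mul, ← map_mul, ← map_add, hst]
    · exact hhs n

/-- The ring of sequences in `R` that are eventually constant with value in the image of `φ`. -/
def seqRing {T R : Type*} [Ring T] [Ring R] (φ : T →+* R) : Subring (ℕ → R) where
  carrier := {f | ∃ t, ∀ᶠ n in Filter.atTop, f n = φ t}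
  mul_mem' := by
    rintro a b ⟨s, hs⟩ ⟨t, ht⟩
    exact ⟨s * t, by filter_upwards [hs, ht] with n h1 h2; simp [h1, h2]⟩
  add_mem' := by
    rintro a b ⟨s, hs⟩ ⟨t, ht⟩
    exact ⟨s + t, by filter_upwards [hs, ht] with n h1 h2; simp [h1, h2]⟩
  one_mem' := ⟨1, by simp⟩
  zero_mem' := ⟨0, by simp⟩
  neg_mem' := by
    rintro a ⟨s, hs⟩
    exact ⟨-s, by filter_upwards [hs] with n h1; simp [h1]⟩

theorem seqRing_matrix_cond {T R : Type*} [Ring T] [Ring R] (φ : T →+* R)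
    (hφ : Function.Injective φ) (N : ℕ)
    (hR : ∀ x : Matrix (Fin N) (Fin N) R, ∃ g, x * g * x = x)
    (hT : CondF (Matrix (Fin N) (Fin N) T))
    (hp : ∀ x y z : Matrix (Fin N) (Fin N) T,
      (∃ h s : Matrix (Fin N) (Fin N) R, φ.mapMatrix y = φ.mapMatrix z * h + s * φ.mapMatrix x) →
        ∃ h s : Matrix (Fin N) (Fin N) T, y = z * h + s * x) :
    CondF (Matrix (Fin N) (Fin N) (seqRing φ)) ∧ CondE (Matrix (Fin N) (Fin N) (seqRing φ)) := by
  refine seq_cond φ.mapMatrix (fun a b h => ?_)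
    (fun n => ((Pi.evalRingHom (fun _ => R) n).comp (seqRing φ).subtype).mapMatrix) ?_ ?_ ?_ hR hT hp
  · ext i j
    exact hφ (congrFun (congrFun h i) j)
  · intro s s' h
    ext i j n
    exact congrFun (congrFun (h n) i) j
  · intro s
    choose t ht using fun i j => (s i j).2
    refine ⟨t, ?_⟩
    have : ∀ᶠ n in Filter.atTop, ∀ i j, (s i j : ℕ → R) n = φ (t i j) := by
      rw [Filter.eventually_all]
      intro i
      rw [Filter.eventually_all]
      exact ht i
    filter_upwards [this] with n hn
    ext i j
    exact hn i j
  · intro r t h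
    refine ⟨fun i j => ⟨fun n => r n i j, t i j, ?_⟩, fun n => ?_⟩
    · filter_upwards [h] with n hn
      rw [hn]; rfl
    · ext i j; rfl

theorem end_regular {k V : Type*} [Field k] [AddCommGroup V] [Module k V] (x : Module.End k V) :
    ∃ g, x * g * x = x := by
  obtain ⟨g, hg⟩ := x.rangeRestrict.exists_rightInverse_of_surjective x.range_rangeRestrict
  obtain ⟨q, hq⟩ := (LinearMap.range x).subtype.exists_leftInverse_of_injective
    (Submodule.ker_subtype _)
  refine ⟨g ∘ₗ q, ?_⟩
  ext v
  have h1 : q (x v) = x.rangeRestrict v := LinearMap.congr_fun hq (x.rangeRestrict v)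
  have h2 := LinearMap.congr_fun hg (x.rangeRestrict v)
  have h3 := congrArg Subtype.val h2
  simpa [h1] using h3

theorem matrix_end_regular {k V : Type*} [Field k] [AddCommGroup V] [Module k V] (N : ℕ)
    (x : Matrix (Fin N) (Fin N) (Module.End k V)) :
    ∃ g, x * g * x = x := by
  let e := endVecRingEquivMatrixEnd (Fin N) k V
  obtain ⟨g, hg⟩ := end_regular (e.symm x)
  refine ⟨e g, ?_⟩
  apply e.symm.injective
  rw [map_mul, map_mul, e.symm_apply_apply, hg]

theorem pid_condF (T : Type*) [CommRing T] [IsDomain T] [IsPrincipalIdealRing T] (N : ℕ) :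
    CondF (Matrix (Fin N) (Fin N) T) := by
  refine CondF.of_equiv (Matrix.toLinAlgEquiv' (R := T) (n := Fin N)).toRingEquiv.symm ?_
  intro z c hzc
  obtain ⟨g, hg⟩ := Module.projective_lifting_property z.rangeRestrict LinearMap.id
    z.surjective_rangeRestrict
  refine ⟨1 - g ∘ₗ z.rangeRestrict, ?_, ?_⟩
  · apply LinearMap.ext
    intro v
    have h2 := congrArg Subtype.val (LinearMap.congr_fun hg (z.rangeRestrict v))
    have h3 : z (g (z.rangeRestrict v)) = z v := h2
    simp [h3]
  · apply LinearMap.ext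
    intro v
    have h2 : z (c v) = 0 := LinearMap.congr_fun hzc v
    have h3 : z.rangeRestrict (c v) = 0 := Subtype.ext h2
    simp [h3]

abbrev qMod (T : Type) [CommRing T] (i : Σ N : ℕ, Matrix (Fin N) (Fin N) T) : Type :=
  (Fin i.1 → T) ⧸ Submodule.span T (Set.range i.2)

abbrev bigMod (T : Type) [CommRing T] : Type :=
  ∀ i : (Σ N : ℕ, Matrix (Fin N) (Fin N) T), qMod T i

/-- The action of `T` on `bigMod T` by `k`-linear maps. -/
noncomputable def bigAct (k T : Type) [Field k] [CommRing T] [Algebra k T] :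
    T →+* Module.End k (bigMod T) :=
  (Algebra.lsmul k k (bigMod T) : T →ₐ[k] _).toRingHom

theorem bigAct_apply (k T : Type) [Field k] [CommRing T] [Algebra k T] (t : T) (v : bigMod T) :
    bigAct k T t v = t • v := rfl

theorem purity (k T : Type) [Field k] [CommRing T] [Algebra k T] (N : ℕ)
    (x y z : Matrix (Fin N) (Fin N) T)
    (H : ∃ h s : Matrix (Fin N) (Fin N) (Module.End k (bigMod T)), (bigAct k T).mapMatrix y =
      (bigAct k T).mapMatrix z * h + s * (bigAct k T).mapMatrix x) :
    ∃ h s : Matrix (Fin N) (Fin N) T, y = z * h + s * x := by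
  classical
  obtain ⟨h, s, H⟩ := H
  let D := qMod T ⟨N, x⟩
  let mk : (Fin N → T) →ₗ[T] D := Submodule.mkQ _
  let u : Fin N → bigMod T := fun i => Pi.single ⟨N, x⟩ (mk (Pi.single i 1))
  have key : ∀ (y : Matrix (Fin N) (Fin N) T) i,
      ∑ j, y i j • u j = Pi.single ⟨N, x⟩ (mk (y i)) := by
    intro y i
    have h1 : ∀ v : Fin N → T, ∑ j, v j • u j =
        (LinearMap.single T (qMod T) ⟨N, x⟩ ∘ₗ mk) v := by
      intro v
      conv_rhs => rw [pi_eq_sum_univ' v, map_sum]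
      refine Finset.sum_congr rfl fun j _ => ?_
      rw [map_smul]
      rfl
    exact h1 (y i)
  have hx : ∀ i, ∑ j, x i j • u j = 0 := by
    intro i
    rw [key]
    have : mk (x i) = 0 := (Submodule.Quotient.mk_eq_zero _).2 (Submodule.subset_span ⟨i, rfl⟩)
    rw [this, Pi.single_zero]
  let w : Fin N → D := fun i => (∑ j, h i j (u j)) ⟨N, x⟩
  have hw : ∀ i, ∃ v, mk v = w i := fun i => Submodule.mkQ_surjective _ _
  choose v hv using hw
  have e1 : ∀ i, mk (y i) = ∑ j, z i j • w j := by
    intro i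
    have a1 : ∑ j, ((bigAct k T).mapMatrix y i j) (u j) =
        ∑ j, (((bigAct k T).mapMatrix z * h + s * (bigAct k T).mapMatrix x) i j) (u j) := by
      rw [H]
    have a2 : ∑ j, ((bigAct k T).mapMatrix y i j) (u j) = Pi.single ⟨N, x⟩ (mk (y i)) :=
      key y i
    have a3 : ∑ j, (((bigAct k T).mapMatrix z * h) i j) (u j) =
        ∑ l, z i l • ∑ j, h l j (u j) := by
      simp only [Matrix.mul_apply, LinearMap.sum_apply, Finset.smul_sum]
      rw [Finset.sum_comm]
      rfl
    have a4 : ∑ j, ((s * (bigAct k T).mapMatrix x) i j) (u j) = 0 := by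
      simp only [Matrix.mul_apply, LinearMap.sum_apply]
      rw [Finset.sum_comm]
      refine Finset.sum_eq_zero fun l _ => ?_
      have : ∑ j, (s i l * (bigAct k T).mapMatrix x l j) (u j) = s i l (∑ j, x l j • u j) := by
        rw [map_sum]; rfl
      rw [this, hx, map_zero]
    have a5 : (Pi.single ⟨N, x⟩ (mk (y i)) : bigMod T) = ∑ l, z i l • ∑ j, h l j (u j) := by
      rw [← a2, a1]
      simp only [Matrix.add_apply, LinearMap.add_apply, Finset.sum_add_distrib]
      rw [a3, a4, add_zero]
    have a6 := congrFun a5 ⟨N, x⟩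
    rw [Pi.single_eq_same] at a6
    rw [a6, Finset.sum_apply]
    rfl
  have e2 : ∀ i, y i - (z * Matrix.of v) i ∈ Submodule.span T (Set.range x) := by
    intro i
    have b1 : mk ((z * Matrix.of v) i) = ∑ j, z i j • w j := by
      have : (z * Matrix.of v) i = ∑ j, z i j • v j := by
        ext l
        simp [Matrix.mul_apply]
      rw [this, map_sum]
      refine Finset.sum_congr rfl fun j _ => ?_
      rw [map_smul, hv]
    exact (Submodule.Quotient.eq _).1 ((e1 i).trans b1.symm)
  have e3 : ∀ i, ∃ c : Fin N → T, ∑ j, c j • x j = y i - (z * Matrix.of v) i := by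
    intro i
    exact (Submodule.mem_span_range_iff_exists_fun T).1 (e2 i)
  choose c hc using e3
  refine ⟨Matrix.of v, Matrix.of c, ?_⟩
  ext i j
  have := congrFun (hc i) j
  rw [Pi.sub_apply, Finset.sum_apply] at this
  have h2 : (Matrix.of c * x) i j = ∑ l, (c i l • x l) j := by
    simp [Matrix.mul_apply]
  rw [Matrix.add_apply, h2, this]
  abel

theorem bigAct_inj (k T : Type) [Field k] [CommRing T] [Algebra k T] :
    Function.Injective (bigAct k T) := by
  intro a b h
  let v : bigMod T := fun _ => Submodule.Quotient.mk (fun _ => 1)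
  have h1 : a • v = b • v := LinearMap.congr_fun h v
  have h2 := congrFun h1 ⟨1, 0⟩
  have h3 : (Submodule.Quotient.mk (fun _ => a) : qMod T ⟨1, 0⟩) =
      Submodule.Quotient.mk (fun _ => b) := by
    have e : ∀ a : T, (a • v) ⟨1, 0⟩ = Submodule.Quotient.mk (fun _ => a) := by
      intro a
      change a • (Submodule.Quotient.mk (fun _ => 1) : qMod T ⟨1, 0⟩) = _
      rw [← Submodule.Quotient.mk_smul]
      congr 1
      ext; simp
    rw [← e, ← e, h2]
  rw [Submodule.Quotient.eq] at h3
  have h4 : Submodule.span T (Set.range (0 : Matrix (Fin 1) (Fin 1) T)) = ⊥ := by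
    rw [Submodule.span_eq_bot]
    rintro _ ⟨i, rfl⟩
    rfl
  have h5 : (fun _ => a) - (fun _ => b) ∈ Submodule.span T (Set.range (0 : Matrix (Fin 1) (Fin 1) T)) := h3
  rw [h4, Submodule.mem_bot] at h5
  exact sub_eq_zero.1 (congrFun h5 0)

theorem exists_cond_ring_abs {T R : Type} [Ring T] [Ring R] (φ : T →+* R)
    (hφ : Function.Injective φ)
    (hR : ∀ (N : ℕ) (x : Matrix (Fin N) (Fin N) R), ∃ g, x * g * x = x)
    (hT : ∀ N : ℕ, CondF (Matrix (Fin N) (Fin N) T))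
    (hp : ∀ (N : ℕ) (x y z : Matrix (Fin N) (Fin N) T),
      (∃ h s : Matrix (Fin N) (Fin N) R, φ.mapMatrix y = φ.mapMatrix z * h + s * φ.mapMatrix x) →
        ∃ h s : Matrix (Fin N) (Fin N) T, y = z * h + s * x)
    (x : T) (hx : ∀ t : T, x ≠ x * t * x) :
    ∃ (S : Type) (_ : Ring S), (∀ N : ℕ, CondF (Matrix (Fin N) (Fin N) S) ∧
      CondE (Matrix (Fin N) (Fin N) S)) ∧ ¬ ∀ x : S, ∃ y : S, x = x * y * x := by
  refine ⟨seqRing φ, inferInstance, fun N => ?_, fun H => ?_⟩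
  · exact seqRing_matrix_cond φ hφ N (hR N) (hT N) (hp N)
  · obtain ⟨y, hy⟩ := H ⟨fun _ => φ x, x, Filter.Eventually.of_forall fun _ => rfl⟩
    obtain ⟨t, ht⟩ := y.2
    obtain ⟨n, hn⟩ := ht.exists
    have h1 := congrFun (congrArg Subtype.val hy) n
    have h2 : φ x = φ x * y.1 n * φ x := h1
    rw [hn, ← map_mul, ← map_mul] at h2
    exact hx t (hφ h2)

theorem exists_cond_ring (k T : Type) [Field k] [CommRing T] [IsDomain T]
    [IsPrincipalIdealRing T] [Algebra k T] (x : T) (hx : ∀ t : T, x ≠ x * t * x) :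
    ∃ (S : Type) (_ : Ring S), (∀ N : ℕ, CondF (Matrix (Fin N) (Fin N) S) ∧
      CondE (Matrix (Fin N) (Fin N) S)) ∧ ¬ ∀ x : S, ∃ y : S, x = x * y * x := by
  refine exists_cond_ring_abs (T := T) (R := Module.End k (bigMod T)) (bigAct k T)
    ?_ ?_ ?_ ?_ x hx
  · exact bigAct_inj k T
  · intro N
    exact matrix_end_regular N
  · intro N
    exact pid_condF T N
  · intro N x y z
    exact purity k T N x y z

theorem end_equiv (S : Type*) [Ring S] (N : ℕ) :
    Nonempty (Matrix (Fin N) (Fin N) S ≃+* Module.End Sᵐᵒᵖ (Fin N → Sᵐᵒᵖ)) :=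
  ⟨(((RingEquiv.opOp S).trans (RingEquiv.moduleEndSelf Sᵐᵒᵖ)).mapMatrix).trans
    (endVecRingEquivMatrixEnd (Fin N) Sᵐᵒᵖ Sᵐᵒᵖ).symm⟩

/-- `M` is a retract of `A ^ N`. -/
def Ret (A : Type*) [Ring A] (N : ℕ) (M : Type*) [AddCommGroup M] [Module A M] : Prop :=
  ∃ (i : M →ₗ[A] (Fin N → A)) (r : (Fin N → A) →ₗ[A] M), ∀ v, r (i v) = v

theorem Ret.mono {A : Type*} [Ring A] {n N : ℕ} (hN : n ≤ N) {M : Type*} [AddCommGroup M]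
    [Module A M] (h : Ret A n M) : Ret A N M := by
  obtain ⟨i, r, h⟩ := h
  refine ⟨Function.ExtendByZero.linearMap A (Fin.castLE hN) ∘ₗ i,
    r ∘ₗ LinearMap.funLeft A A (Fin.castLE hN), fun v => ?_⟩
  have : LinearMap.funLeft A A (Fin.castLE hN)
      (Function.ExtendByZero.linearMap A (Fin.castLE hN) (i v)) = i v := by
    ext j
    simp [LinearMap.funLeft, (Fin.castLE_injective hN).extend_apply]
  simp only [LinearMap.comp_apply, this, h]

theorem ret_exists (A : Type*) [Ring A] (M : Type*) [AddCommGroup M] [Module A M]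
    (h : Module.Finite A M ∧ Module.Projective A M) : ∃ n, Ret A n M := by
  obtain ⟨h1, h2⟩ := h
  obtain ⟨n, f, g, -, -, hfg⟩ := Module.Finite.exists_comp_eq_id_of_projective A M
  exact ⟨n, g, f, fun v => LinearMap.congr_fun hfg v⟩

theorem ret_F {A : Type*} [Ring A] {N : ℕ} (hF : CondF (Module.End A (Fin N → A)))
    {M Q P : Type*} [AddCommGroup M] [AddCommGroup Q] [AddCommGroup P]
    [Module A M] [Module A Q] [Module A P] (hM : Ret A N M) (hQ : Ret A N Q) (hP : Ret A N P)
    (c : M →ₗ[A] Q) (z : Q →ₗ[A] P) (hzc : ∀ v, z (c v) = 0) :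
    ∃ b : Q →ₗ[A] Q, (∀ v, z (b v) = 0) ∧ ∀ v, b (c v) = c v := by
  obtain ⟨iM, rM, hM⟩ := hM
  obtain ⟨iQ, rQ, hQ⟩ := hQ
  obtain ⟨iP, rP, hP⟩ := hP
  obtain ⟨b, h1, h2⟩ := hF (iP ∘ₗ z ∘ₗ rQ) (iQ ∘ₗ c ∘ₗ rM) (by
    apply LinearMap.ext
    intro v
    simp [hQ, hzc])
  refine ⟨rQ ∘ₗ b ∘ₗ iQ, fun v => ?_, fun v => ?_⟩
  · have := congrArg rP (LinearMap.congr_fun h1 (iQ v))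
    simpa [hP] using this
  · have := congrArg rQ (LinearMap.congr_fun h2 (iM v))
    simpa [hM, hQ] using this

theorem ret_E {A : Type*} [Ring A] {N : ℕ} (hE : CondE (Module.End A (Fin N → A)))
    {F P Q Q' : Type*} [AddCommGroup F] [AddCommGroup Q] [AddCommGroup P] [AddCommGroup Q']
    [Module A F] [Module A Q] [Module A P] [Module A Q']
    (hF : Ret A N F) (hQ : Ret A N Q) (hP : Ret A N P) (hQ' : Ret A N Q')
    (x : F →ₗ[A] P) (y : F →ₗ[A] Q) (z : Q' →ₗ[A] Q) (H : ∀ v, x v = 0 → ∃ w, z w = y v) :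
    ∃ (h : F →ₗ[A] Q') (s : P →ₗ[A] Q), ∀ v, y v = z (h v) + s (x v) := by
  obtain ⟨iF, rF, hF⟩ := hF
  obtain ⟨iQ, rQ, hQ⟩ := hQ
  obtain ⟨iP, rP, hP⟩ := hP
  obtain ⟨iQ', rQ', hQ'⟩ := hQ'
  obtain ⟨h, s, hs⟩ := hE (iP ∘ₗ x ∘ₗ rF) (iQ ∘ₗ y ∘ₗ rF) (iQ ∘ₗ z ∘ₗ rQ') (by
    intro a ha
    have h0 : ∀ v, ∃ w, z w = y (rF (a v)) := by
      intro v
      apply H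
      have := congrArg rP (LinearMap.congr_fun ha v)
      simpa [hP] using this
    obtain ⟨w, hw⟩ := Module.projective_lifting_property z.rangeRestrict
      ((y ∘ₗ rF ∘ₗ a).codRestrict (LinearMap.range z) (fun v => h0 v))
      z.surjective_rangeRestrict
    refine ⟨iQ' ∘ₗ w, ?_⟩
    apply LinearMap.ext
    intro v
    have h1 : z (w v) = y (rF (a v)) := congrArg Subtype.val (LinearMap.congr_fun hw v)
    simp [hQ', h1])
  refine ⟨rQ' ∘ₗ h ∘ₗ iF, rQ ∘ₗ s ∘ₗ iP, fun v => ?_⟩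
  have := congrArg rQ (LinearMap.congr_fun hs (iF v))
  simpa [hF, hQ] using this

theorem ghost_elem {A : Type} [Ring A] {P Q : ChainComplex (ModuleCat.{0} A) ℤ} (f : P ⟶ Q)
    (n m l : ℤ) (hm : m + 1 = n) (hl : n + 1 = l)
    (hf : homologyMap f n = 0) (v : P.X n) (hv : (P.d n m).hom v = 0) :
    ∃ w : Q.X l, (Q.d l n).hom w = (f.f n).hom v := by
  have hnext : (ComplexShape.down ℤ).next n = m := ComplexShape.next_eq' _ (by simpa using hm)
  have hprev : (ComplexShape.down ℤ).prev n = l := ComplexShape.prev_eq' _ (by simpa using hl)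
  let κ : ModuleCat.of A A ⟶ P.X n := ModuleCat.ofHom (LinearMap.toSpanSingleton A (P.X n) v)
  have hκ : κ ≫ P.d n m = 0 := by
    ext
    simp [κ, hv]
  have hκ' : (κ ≫ f.f n) ≫ Q.d n m = 0 := by
    rw [Category.assoc, f.comm, ← Category.assoc, hκ, zero_comp]
  have h1 : Q.liftCycles (κ ≫ f.f n) m hnext hκ' ≫ Q.homologyπ n = 0 := by
    have : Q.liftCycles (κ ≫ f.f n) m hnext hκ' = P.liftCycles κ m hnext hκ ≫ cyclesMap f n := by
      rw [← cancel_mono (Q.iCycles n)]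
      simp
    rw [this, Category.assoc, ← homologyπ_naturality, hf, comp_zero, comp_zero]
  rw [Q.liftCycles_comp_homologyπ_eq_zero_iff_up_to_refinements _ _ _ hprev] at h1
  obtain ⟨A', π, hπ, x, hx⟩ := h1
  obtain ⟨a, ha⟩ := (ModuleCat.epi_iff_surjective π).1 hπ (1 : A)
  refine ⟨x.hom a, ?_⟩
  have h2 := LinearMap.congr_fun (congrArg ModuleCat.Hom.hom hx) a
  have ha' : π.hom a = (1 : A) := ha
  have h3 : (f.f n).hom (κ.hom (π.hom a)) = (Q.d l n).hom (x.hom a) := h2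
  rw [← h3, ha']
  simp [κ]

/-- family of maps supported in one degree -/
noncomputable def oneHom {A : Type} [Ring A] {P Q : ChainComplex (ModuleCat.{0} A) ℤ} (n l : ℤ)
    (α : P.X n ⟶ Q.X l) (i j : ℤ) : P.X i ⟶ Q.X j :=
  if h : i = n ∧ j = l then
    eqToHom (by rw [h.1]) ≫ α ≫ eqToHom (by rw [h.2]) else 0

theorem oneHom_self {A : Type} [Ring A] {P Q : ChainComplex (ModuleCat.{0} A) ℤ} (n l : ℤ)
    (α : P.X n ⟶ Q.X l) : oneHom n l α n l = α := by
  simp [oneHom]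

theorem oneHom_ne {A : Type} [Ring A] {P Q : ChainComplex (ModuleCat.{0} A) ℤ} (n l : ℤ)
    (α : P.X n ⟶ Q.X l) (i j : ℤ) (h : ¬ (i = n ∧ j = l)) : oneHom n l α i j = 0 := by
  simp [oneHom, h]

theorem gh_step_s16 {A : Type} [Ring A] (hF : ∀ N : ℕ, CondF (Module.End A (Fin N → A)))
    (hE : ∀ N : ℕ, CondE (Module.End A (Fin N → A)))
    {P Q : ChainComplex (ModuleCat.{0} A) ℤ}
    (hP : ∀ n, Module.Finite A (P.X n) ∧ Module.Projective A (P.X n))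
    (hQ : ∀ n, Module.Finite A (Q.X n) ∧ Module.Projective A (Q.X n))
    (f : P ⟶ Q) (hf : ∀ n, homologyMap f n = 0) (n : ℤ) (h0 : ∀ i, n < i → f.f i = 0) :
    ∃ f' : P ⟶ Q, Nonempty (Homotopy f f') ∧ ∀ i, n ≤ i → f'.f i = 0 := by
  obtain ⟨n1, r1⟩ := ret_exists A (P.X (n + 1)) (hP _)
  obtain ⟨n2, r2⟩ := ret_exists A (P.X n) (hP _)
  obtain ⟨n3, r3⟩ := ret_exists A (P.X (n - 1)) (hP _)
  obtain ⟨n4, r4⟩ := ret_exists A (Q.X (n + 1)) (hQ _)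
  obtain ⟨n5, r5⟩ := ret_exists A (Q.X n) (hQ _)
  let N := n1 + n2 + n3 + n4 + n5
  replace r1 := r1.mono (show n1 ≤ N by omega)
  replace r2 := r2.mono (show n2 ≤ N by omega)
  replace r3 := r3.mono (show n3 ≤ N by omega)
  replace r4 := r4.mono (show n4 ≤ N by omega)
  replace r5 := r5.mono (show n5 ≤ N by omega)
  obtain ⟨h, s, hs⟩ := ret_E (hE N) r2 r5 r3 r4 (P.d n (n - 1)).hom (f.f n).hom
    (Q.d (n + 1) n).hom (fun v hv => ghost_elem f n (n - 1) (n + 1) (by omega) rfl (hf n) v hv)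
  have hd : ∀ v, (P.d n (n - 1)).hom ((P.d (n + 1) n).hom v) = 0 := fun v =>
    LinearMap.congr_fun (congrArg ModuleCat.Hom.hom (P.d_comp_d (n + 1) n (n - 1))) v
  have hfd : ∀ v, (f.f n).hom ((P.d (n + 1) n).hom v) = 0 := fun v => by
    have := LinearMap.congr_fun (congrArg ModuleCat.Hom.hom (f.comm (n + 1) n)) v
    rw [h0 (n + 1) (by omega)] at this
    simpa using this.symm
  obtain ⟨b, hb1, hb2⟩ := ret_F (hF N) r1 r4 r5 (h ∘ₗ (P.d (n + 1) n).hom)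
    (Q.d (n + 1) n).hom (fun v => by
      have := hs ((P.d (n + 1) n).hom v)
      rw [hfd, hd, map_zero, add_zero] at this
      exact this.symm)
  let α : P.X n ⟶ Q.X (n + 1) := ModuleCat.ofHom (h - b ∘ₗ h)
  let β : P.X (n - 1) ⟶ Q.X n := ModuleCat.ofHom s
  have hα : P.d (n + 1) n ≫ α = 0 := by
    ext v
    have := hb2 v
    simp only [LinearMap.comp_apply] at this
    simp [α, this]
  have hαβ : f.f n = P.d n (n - 1) ≫ β + α ≫ Q.d (n + 1) n := by
    ext v
    simp [α, β, hs, hb1, add_comm]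
  let hom : ∀ i j, P.X i ⟶ Q.X j := fun i j => oneHom n (n + 1) α i j + oneHom (n - 1) n β i j
  have hzero : ∀ i j, ¬ (ComplexShape.down ℤ).Rel j i → hom i j = 0 := by
    intro i j hij
    simp only [ComplexShape.down_Rel] at hij
    simp only [hom]
    rw [oneHom_ne, oneHom_ne, add_zero] <;> omega
  have hmap : ∀ i, (Homotopy.nullHomotopicMap hom).f i =
      P.d i (i - 1) ≫ hom (i - 1) i + hom i (i + 1) ≫ Q.d (i + 1) i := fun i =>
    Homotopy.nullHomotopicMap_f (by simp) (by simp) hom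
  refine ⟨f - Homotopy.nullHomotopicMap hom, ⟨?_⟩, ?_⟩
  · exact Homotopy.equivSubZero.symm
      ((Homotopy.ofEq (by simp)).trans (Homotopy.nullHomotopy hom hzero))
  · intro i hi
    rw [HomologicalComplex.sub_f_apply, hmap]
    rcases eq_or_lt_of_le hi with rfl | hi
    · have e1 : hom (n - 1) n = β := by
        simp only [hom]
        rw [oneHom_ne _ _ _ _ _ (by omega), oneHom_self, zero_add]
      have e2 : hom n (n + 1) = α := by
        simp only [hom]
        rw [oneHom_ne (n - 1) _ _ _ _ (by omega), oneHom_self, add_zero]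
      rw [e1, e2, hαβ, sub_self]
    · rw [h0 i hi]
      have e2 : hom i (i + 1) = 0 := by
        simp only [hom]
        rw [oneHom_ne _ _ _ _ _ (by omega), oneHom_ne _ _ _ _ _ (by omega), add_zero]
      have e1 : P.d i (i - 1) ≫ hom (i - 1) i = 0 := by
        by_cases hin : i = n + 1
        · subst hin
          have : ∀ m, m = n → P.d (n + 1) m ≫ hom m (n + 1) = 0 := by
            rintro m rfl
            simp only [hom]
            rw [oneHom_ne (m - 1) _ _ _ _ (by omega), oneHom_self, add_zero, hα]
          exact this _ (by omega)
        · simp only [hom]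
          rw [oneHom_ne _ _ _ _ _ (by omega), oneHom_ne _ _ _ _ _ (by omega), add_zero, comp_zero]
      rw [e1, e2, zero_comp, add_zero, sub_zero]

theorem gh_main {A : Type} [Ring A] (hF : ∀ N : ℕ, CondF (Module.End A (Fin N → A)))
    (hE : ∀ N : ℕ, CondE (Module.End A (Fin N → A)))
    {P Q : ChainComplex (ModuleCat.{0} A) ℤ}
    (hP : ∀ n, Module.Finite A (P.X n) ∧ Module.Projective A (P.X n))
    (hQ : ∀ n, Module.Finite A (Q.X n) ∧ Module.Projective A (Q.X n))
    (a : ℤ) (ha : ∀ n, n < a → IsZero (P.X n)) (k : ℕ) :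
    ∀ (f : P ⟶ Q) (_ : ∀ n, homologyMap f n = 0) (_ : ∀ i, a + k ≤ i → f.f i = 0),
      Nonempty (Homotopy f 0) := by
  induction k with
  | zero =>
    intro f _ h0
    have : f = 0 := by
      ext1 i
      by_cases hi : i < a
      · exact (ha i hi).eq_of_src _ _
      · exact h0 i (by simpa using hi)
    exact ⟨Homotopy.ofEq this⟩
  | succ k ih =>
    intro f hf h0
    obtain ⟨f', ⟨H⟩, h'⟩ := gh_step_s16 hF hE hP hQ f hf (a + k) (fun i hi => h0 i (by push_cast; omega))
    obtain ⟨H'⟩ := ih f' (fun n => by rw [← H.homologyMap_eq, hf]) h'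
    exact ⟨H.trans H'⟩

theorem satisfiesGH_of_cond (S : Type) [Ring S]
    (h : ∀ N : ℕ, CondF (Matrix (Fin N) (Fin N) S) ∧ CondE (Matrix (Fin N) (Fin N) S)) :
    SatisfiesGH S := by
  rintro P Q ⟨⟨a, b, hab⟩, hP⟩ ⟨-, hQ⟩ f hf
  refine gh_main (fun N => ?_) (fun N => ?_) hP hQ a (fun n hn => hab n (Or.inl hn))
    (b + 1 - a).toNat f hf (fun i hi => (hab i (Or.inr (by omega))).eq_of_src _ _)
  · obtain ⟨e⟩ := end_equiv S N
    exact (h N).1.of_equiv e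
  · obtain ⟨e⟩ := end_equiv S N
    exact (h N).2.of_equiv e

theorem exists_ring_satisfying_gh_not_vonNeumannRegular :
    ∃ (S : Type) (_ : Ring S), SatisfiesGH S ∧ ¬∀ x : S, ∃ y : S, x = x * y * x := by
  obtain ⟨S, iS, h, hn⟩ := exists_cond_ring ℚ (Polynomial ℚ) Polynomial.X (by
    intro t ht
    have h3 := congrArg (fun p => Polynomial.coeff p 1) ht
    simp [Polynomial.coeff_X_one] at h3)
  exact ⟨S, iS, satisfiesGH_of_cond S h, hn⟩
end
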